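/- arXiv:2211.10757 — 3 statements merged into one kernel-verified Lean document; each statement's English description precedes it below -/
import Mathlib

section
/- Let Ω ⊂ ℝ³ be a bounded domain whose boundary ∂Ω consists of two distinct level sets of a smooth function Ψ : Ω → ℝ with ∇Ψ ≠ 0 on Ω, and suppose the level sets of Ψ foliate Ω by nested toroidal surfaces carrying angle coordinates with smooth gradients; precisely, suppose there is a smooth diffeomorphism G from (ℝ/2πℤ)² × (s₀,s₁) onto Ω such that Ψ(G(μ,ν,s)) = s for all (μ,ν,s). Then there exists a nontrivial smooth vector field w : Ω → ℝ³ satisfying [(∇×w)×w]×∇Ψ = 0 and ∇·w = 0 throughout Ω, and such that w and ∇×w are not everywhere collinear in Ω. -/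
/-- Partial derivative of a scalar field on `ℝ³` in the `i`-th coordinate direction. -/
noncomputable def pd (i : Fin 3) (f : (Fin 3 → ℝ) → ℝ) (x : Fin 3 → ℝ) : ℝ :=
  fderiv ℝ f x (Pi.single i 1)

/-- Gradient of a scalar field on `ℝ³`. -/
noncomputable def grad (f : (Fin 3 → ℝ) → ℝ) (x : Fin 3 → ℝ) : Fin 3 → ℝ :=
  ![pd 0 f x, pd 1 f x, pd 2 f x]

/-- Divergence of a vector field on `ℝ³`. -/
noncomputable def div3 (w : (Fin 3 → ℝ) → (Fin 3 → ℝ)) (x : Fin 3 → ℝ) : ℝ :=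
  pd 0 (fun y => w y 0) x + pd 1 (fun y => w y 1) x + pd 2 (fun y => w y 2) x

/-- Curl of a vector field on `ℝ³`. -/
noncomputable def curl (w : (Fin 3 → ℝ) → (Fin 3 → ℝ)) (x : Fin 3 → ℝ) : Fin 3 → ℝ :=
  ![pd 1 (fun y => w y 2) x - pd 2 (fun y => w y 1) x,
    pd 2 (fun y => w y 0) x - pd 0 (fun y => w y 2) x,
    pd 0 (fun y => w y 1) x - pd 1 (fun y => w y 0) x]

/-- Cross product on `ℝ³`. -/
def cross3 (u v : Fin 3 → ℝ) : Fin 3 → ℝ :=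
  ![u 1 * v 2 - u 2 * v 1, u 2 * v 0 - u 0 * v 2, u 0 * v 1 - u 1 * v 0]

/-- Dot product on `ℝ³`. -/
def dot3 (u v : Fin 3 → ℝ) : ℝ := u 0 * v 0 + u 1 * v 1 + u 2 * v 2

open scoped Real

section

open MeasureTheory

/-- `(ℝ/2πℤ)²` -/
abbrev Torus : Type := AddCircle (2 * π) × AddCircle (2 * π)

def torusShift (a : ℝ × ℝ) : Fin 3 → ℝ := ![a.1, a.2, 0]

noncomputable def torusMk (a : ℝ × ℝ) : Torus := (a.1, a.2)

instance : Fact (0 < 2 * π) := ⟨Real.two_pi_pos⟩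

/-- Smooth functions that are `2π`-periodic in the first two coordinates. -/
structure SmoothPeriodic {F : Type*} [NormedAddCommGroup F] [NormedSpace ℝ F]
    (g : (Fin 3 → ℝ) → F) : Prop where
  contDiff : ContDiff ℝ (⊤ : ℕ∞) g
  periodic₀ : ∀ p, g (p + Pi.single 0 (2 * π)) = g p
  periodic₁ : ∀ p, g (p + Pi.single 1 (2 * π)) = g p

theorem isOpenQuotientMap_torusMk : IsOpenQuotientMap torusMk :=
  (QuotientAddGroup.isOpenQuotientMap_mk (N := AddSubgroup.zmultiples (2 * π))).prodMap
    (QuotientAddGroup.isOpenQuotientMap_mk (N := AddSubgroup.zmultiples (2 * π)))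

theorem torusShift_add (a b : ℝ × ℝ) : torusShift (a + b) = torusShift a + torusShift b := by
  ext i; fin_cases i <;> simp [torusShift]

theorem torusMk_add (a b : ℝ × ℝ) : torusMk (a + b) = torusMk a + torusMk b := rfl

@[fun_prop]
theorem continuous_torusShift : Continuous torusShift := by
  unfold torusShift; fun_prop

namespace SmoothPeriodic

variable {F : Type*} [NormedAddCommGroup F] [NormedSpace ℝ F] {g : (Fin 3 → ℝ) → F}

theorem add_zsmul (hg : SmoothPeriodic g) (p : Fin 3 → ℝ) (m n : ℤ) :
    g (p + m • Pi.single 0 (2 * π) + n • Pi.single 1 (2 * π)) = g p := by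
  have h0 : Function.Periodic g (Pi.single 0 (2 * π)) := hg.periodic₀
  have h1 : Function.Periodic g (Pi.single 1 (2 * π)) := hg.periodic₁
  rw [h1.zsmul n, h0.zsmul m]

theorem eq_of_torusMk_eq (hg : SmoothPeriodic g) (p : Fin 3 → ℝ) {a b : ℝ × ℝ}
    (hab : torusMk a = torusMk b) : g (p + torusShift a) = g (p + torusShift b) := by
  obtain ⟨h0, h1⟩ := Prod.ext_iff.1 hab
  obtain ⟨m, hm⟩ := AddCircle.coe_eq_zero_iff (2 * π) |>.1
    (show ((a.1 - b.1 : ℝ) : AddCircle (2 * π)) = 0 by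
      rw [AddCircle.coe_sub]; exact sub_eq_zero.2 h0)
  obtain ⟨n, hn⟩ := AddCircle.coe_eq_zero_iff (2 * π) |>.1
    (show ((a.2 - b.2 : ℝ) : AddCircle (2 * π)) = 0 by
      rw [AddCircle.coe_sub]; exact sub_eq_zero.2 h1)
  rw [← hg.add_zsmul (p + torusShift b) m n]
  congr 1
  ext i
  simp only [zsmul_eq_mul] at hm hn
  simp only [Pi.add_apply, zsmul_eq_mul, torusShift]
  fin_cases i <;> simp <;> linarith

/-- A representative of a point of the torus. -/
noncomputable def _root_.torusRep (x : Torus) : ℝ × ℝ := (x.1.out, x.2.out)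

theorem _root_.torusMk_torusRep (x : Torus) : torusMk (torusRep x) = x :=
  Prod.ext (QuotientAddGroup.out_eq' x.1) (QuotientAddGroup.out_eq' x.2)

theorem apply_torusRep (hg : SmoothPeriodic g) (p : Fin 3 → ℝ) (a : ℝ × ℝ) :
    g (p + torusShift (torusRep (torusMk a))) = g (p + torusShift a) :=
  hg.eq_of_torusMk_eq p (torusMk_torusRep _)

theorem continuous_uncurry (hg : SmoothPeriodic g) :
    Continuous fun q : (Fin 3 → ℝ) × Torus => g (q.1 + torusShift (torusRep q.2)) := by
  rw [← (IsOpenQuotientMap.id.prodMap isOpenQuotientMap_torusMk).continuous_comp_iff]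
  have : Continuous fun q : (Fin 3 → ℝ) × (ℝ × ℝ) => g (q.1 + torusShift q.2) :=
    hg.contDiff.continuous.comp
      (continuous_fst.add (continuous_torusShift.comp continuous_snd))
  refine this.congr fun q => ?_
  simp [apply_torusRep hg]

/-- The restriction of a periodic function to the torus through `p`. -/
noncomputable def onTorus (hg : SmoothPeriodic g) (p : Fin 3 → ℝ) : C(Torus, F) :=
  ⟨fun x => g (p + torusShift (torusRep x)),
    hg.continuous_uncurry.comp (Continuous.prodMk_right p)⟩

theorem onTorus_torusMk (hg : SmoothPeriodic g) (p : Fin 3 → ℝ) (a : ℝ × ℝ) :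
    hg.onTorus p (torusMk a) = g (p + torusShift a) := hg.apply_torusRep p a

theorem onTorus_add (hg : SmoothPeriodic g) (p : Fin 3 → ℝ) (a : ℝ × ℝ) (x : Torus) :
    hg.onTorus (p + torusShift a) x = hg.onTorus p (x + torusMk a) := by
  obtain ⟨b, rfl⟩ := isOpenQuotientMap_torusMk.surjective x
  rw [← torusMk_add, onTorus_torusMk, onTorus_torusMk, torusShift_add, add_assoc,
    add_comm (torusShift a)]

theorem continuous_onTorus (hg : SmoothPeriodic g) : Continuous hg.onTorus :=
  ContinuousMap.continuous_of_continuous_uncurry _ hg.continuous_uncurry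

theorem fderiv (hg : SmoothPeriodic g) : SmoothPeriodic (fderiv ℝ g) where
  contDiff := hg.contDiff.fderiv_right (by simp)
  periodic₀ p := by
    rw [← fderiv_comp_add_right]; congr 1; ext1 q; exact hg.periodic₀ q
  periodic₁ p := by
    rw [← fderiv_comp_add_right]; congr 1; ext1 q; exact hg.periodic₁ q

/-- Evaluation of a family of linear maps in a fixed direction, as a linear map. -/
noncomputable def _root_.ContinuousMap.flipEval (X E F : Type*) [TopologicalSpace X]
    [CompactSpace X] [NormedAddCommGroup E] [NormedSpace ℝ E]
    [NormedAddCommGroup F] [NormedSpace ℝ F] : C(X, E →L[ℝ] F) →L[ℝ] E →L[ℝ] C(X, F) :=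
  LinearMap.mkContinuous₂
    (LinearMap.mk₂ ℝ
      (fun (A : C(X, E →L[ℝ] F)) (v : E) => (⟨fun x => A x v, by fun_prop⟩ : C(X, F)))
      (fun _ _ _ => by ext; simp) (fun _ _ _ => by ext; simp) (fun _ _ _ => by ext; simp)
      (fun _ _ _ => by ext; simp)) 1
    (fun A v => by
      rw [one_mul, ContinuousMap.norm_le _ (by positivity)]
      intro x
      exact (A x).le_of_opNorm_le (A.norm_coe_le_norm x) v)

@[simp] theorem _root_.ContinuousMap.flipEval_apply {X E F : Type*} [TopologicalSpace X]
    [CompactSpace X] [NormedAddCommGroup E] [NormedSpace ℝ E]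
    [NormedAddCommGroup F] [NormedSpace ℝ F] (A : C(X, E →L[ℝ] F)) (v : E) (x : X) :
    ContinuousMap.flipEval X E F A v x = A x v := rfl

theorem hasFDerivAt_onTorus (hg : SmoothPeriodic g) (p : Fin 3 → ℝ) :
    HasFDerivAt hg.onTorus (ContinuousMap.flipEval Torus _ F (hg.fderiv.onTorus p)) p := by
  rw [hasFDerivAt_iff_isLittleO_nhds_zero, Asymptotics.isLittleO_iff]
  intro c hc
  have hcont := hg.fderiv.continuous_onTorus.tendsto p
  obtain ⟨δ, hδ, hball⟩ := Metric.eventually_nhds_iff.1 (Metric.tendsto_nhds.1 hcont c hc)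
  filter_upwards [Metric.ball_mem_nhds (0 : Fin 3 → ℝ) hδ] with h hh
  rw [ContinuousMap.norm_le _ (by positivity)]
  intro x
  have key := (convex_ball p δ).norm_image_sub_le_of_norm_fderiv_le' (𝕜 := ℝ)
    (f := fun q => g (q + torusShift (torusRep x))) (C := c) (x := p) (y := p + h)
    (φ := hg.fderiv.onTorus p x) (fun q _ => ?_) (fun q hq => ?_)
    (Metric.mem_ball_self hδ) (by simpa using hh)
  · simpa [onTorus] using key
  · exact ((hg.contDiff.differentiable (by simp)).differentiableAt).comp q
      (differentiableAt_id.add_const _)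
  · rw [fderiv_comp_add_right]
    have := hball hq
    rw [dist_eq_norm] at this
    exact ((hg.fderiv.onTorus q - hg.fderiv.onTorus p).norm_coe_le_norm x).trans this.le

theorem contDiff_onTorus (hg : SmoothPeriodic g) : ContDiff ℝ (⊤ : ℕ∞) hg.onTorus := by
  rw [contDiff_infty]
  intro n
  induction n generalizing F with
  | zero => exact contDiff_zero.2 hg.continuous_onTorus
  | succ n ih =>
    have h : ContDiff ℝ n fun p => ContinuousMap.flipEval Torus _ F (hg.fderiv.onTorus p) :=
      (ih hg.fderiv).continuousLinearMap_comp (ContinuousMap.flipEval Torus (Fin 3 → ℝ) F)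
    exact contDiff_succ_iff_hasFDerivAt.2 ⟨_, h, hg.hasFDerivAt_onTorus⟩

end SmoothPeriodic

/-- Square-integrable vector fields on the torus. -/
abbrev TorusL2 : Type := Lp (EuclideanSpace ℝ (Fin 2)) 2 (volume : Measure Torus)

instance : (volume : Measure Torus).IsAddHaarMeasure :=
  inferInstanceAs (Measure.IsAddHaarMeasure
    ((volume : Measure (AddCircle (2 * π))).prod (volume : Measure (AddCircle (2 * π)))))

namespace TorusL2

noncomputable def ofContinuous : C(Torus, EuclideanSpace ℝ (Fin 2)) →L[ℝ] TorusL2 :=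
  ContinuousMap.toLp 2 volume ℝ

theorem coeFn_ofContinuous (f : C(Torus, EuclideanSpace ℝ (Fin 2))) :
    ofContinuous f =ᵐ[volume] f := ContinuousMap.coeFn_toLp (𝕜 := ℝ) volume f

theorem denseRange_ofContinuous : DenseRange ofContinuous :=
  ContinuousMap.toLp_denseRange _ _ _ (by simp)

theorem ofContinuous_injective : Function.Injective ofContinuous :=
  ContinuousMap.toLp_injective volume

theorem inner_ofContinuous (f g : C(Torus, EuclideanSpace ℝ (Fin 2))) :
    inner ℝ (ofContinuous f) (ofContinuous g) = ∫ x, inner ℝ (f x) (g x) := by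
  rw [L2.inner_def]
  apply integral_congr_ae
  filter_upwards [coeFn_ofContinuous f, coeFn_ofContinuous g] with x hf hg
  rw [hf, hg]

/-- Translation by `r` of a square-integrable vector field on the torus. -/
noncomputable def translate (r : Torus) : TorusL2 →ₗᵢ[ℝ] TorusL2 :=
  Lp.compMeasurePreservingₗᵢ ℝ (· + r) (measurePreserving_add_right volume r)

theorem translate_ofContinuous (r : Torus) (f : C(Torus, EuclideanSpace ℝ (Fin 2))) :
    translate r (ofContinuous f) = ofContinuous (f.comp ⟨(· + r), by fun_prop⟩) := rfl

/-- Pointwise application of a continuous matrix field, as an operator on vector fields. -/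
noncomputable def mulOp :
    C(Torus, EuclideanSpace ℝ (Fin 2) →L[ℝ] EuclideanSpace ℝ (Fin 2)) →L[ℝ]
      TorusL2 →L[ℝ] TorusL2 :=
  ((ContinuousLinearMap.id ℝ (EuclideanSpace ℝ (Fin 2) →L[ℝ] EuclideanSpace ℝ (Fin 2))).holderL
    volume ⊤ 2 2).comp (ContinuousMap.toLp ⊤ volume ℝ)

theorem mulOp_ofContinuous
    (A : C(Torus, EuclideanSpace ℝ (Fin 2) →L[ℝ] EuclideanSpace ℝ (Fin 2)))
    (f : C(Torus, EuclideanSpace ℝ (Fin 2))) :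
    mulOp A (ofContinuous f) = ofContinuous ⟨fun x => A x (f x), by fun_prop⟩ := by
  apply Lp.ext
  refine (ContinuousLinearMap.coeFn_holder _ _ _).trans ?_
  filter_upwards [coeFn_ofContinuous f, ContinuousMap.coeFn_toLp (𝕜 := ℝ) (p := ⊤) volume A,
    coeFn_ofContinuous ⟨fun x => A x (f x), by fun_prop⟩] with x h1 h2 h3
  rw [h3, h1]
  exact congrArg (fun L => L (f x)) h2

theorem translate_mulOp (r : Torus)
    (A B : C(Torus, EuclideanSpace ℝ (Fin 2) →L[ℝ] EuclideanSpace ℝ (Fin 2)))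
    (hAB : ∀ x, B x = A (x + r)) (u : TorusL2) :
    translate r (mulOp A u) = mulOp B (translate r u) := by
  refine denseRange_ofContinuous.induction_on u ?_ fun f => ?_
  · exact isClosed_eq ((translate r).continuous.comp (mulOp A).continuous)
      ((mulOp B).continuous.comp (translate r).continuous)
  · rw [mulOp_ofContinuous, translate_ofContinuous, translate_ofContinuous, mulOp_ofContinuous]
    congr 1
    ext1 x
    simp [hAB]

theorem le_inner_mulOp
    (A : C(Torus, EuclideanSpace ℝ (Fin 2) →L[ℝ] EuclideanSpace ℝ (Fin 2))) (c : ℝ)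
    (hA : ∀ x v, c * inner ℝ v v ≤ inner ℝ (A x v) v) (u : TorusL2) :
    c * inner ℝ u u ≤ inner ℝ (mulOp A u) u := by
  refine denseRange_ofContinuous.induction_on u ?_ fun f => ?_
  · exact isClosed_le (by fun_prop) (by fun_prop)
  · rw [mulOp_ofContinuous, inner_ofContinuous, inner_ofContinuous, ← integral_const_mul]
    refine integral_mono ?_ ?_ fun x => hA x (f x)
    · exact Continuous.integrable_of_hasCompactSupport (by fun_prop) (.of_compactSpace _)
    · exact Continuous.integrable_of_hasCompactSupport
        (by simp only [ContinuousMap.coe_mk]; fun_prop) (.of_compactSpace _)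

end TorusL2

namespace TorusL2

/-- A fundamental square of the torus. -/
def square : Set (ℝ × ℝ) := Set.Ioc 0 (2 * π) ×ˢ Set.Ioc 0 (2 * π)

theorem measurePreserving_torusMk :
    MeasurePreserving torusMk (volume.restrict square) (volume : Measure Torus) := by
  have h := AddCircle.measurePreserving_mk (2 * π) 0
  have := h.prod h
  rw [Measure.prod_restrict, zero_add] at this
  exact this

theorem continuous_torusMk : Continuous torusMk := isOpenQuotientMap_torusMk.continuous

theorem integrableOn_square {F : Type*} [NormedAddCommGroup F] {f : ℝ × ℝ → F}
    (hf : Continuous f) : IntegrableOn f square :=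
  (hf.continuousOn.integrableOn_compact
    (K := Set.Icc 0 (2 * π) ×ˢ Set.Icc 0 (2 * π)) (isCompact_Icc.prod isCompact_Icc)).mono_set
    (Set.prod_mono Set.Ioc_subset_Icc_self Set.Ioc_subset_Icc_self)

theorem integral_norm_le (u : C(Torus, EuclideanSpace ℝ (Fin 2))) :
    ∫ x, ‖u x‖ ≤ √(volume.real (Set.univ : Set Torus)) * ‖ofContinuous u‖ := by
  have hi : ∀ g : Torus → ℝ, Continuous g → Integrable g := fun g hg =>
    hg.integrable_of_hasCompactSupport (.of_compactSpace _)
  set S := ∫ x, ‖u x‖ with hS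
  set W := volume.real (Set.univ : Set Torus) with hW
  have hWpos : 0 < W := by
    rw [hW, measureReal_def, ENNReal.toReal_pos_iff]
    exact ⟨isOpen_univ.measure_pos _ Set.univ_nonempty, measure_lt_top _ _⟩
  have hN : ‖ofContinuous u‖ ^ 2 = ∫ x, ‖u x‖ ^ 2 := by
    rw [← real_inner_self_eq_norm_sq, inner_ofContinuous]
    simp
  have h0 : 0 ≤ ∫ x, (‖u x‖ - S / W) ^ 2 := integral_nonneg fun x => sq_nonneg _
  have h1 : ∫ x, (‖u x‖ - S / W) ^ 2 = ‖ofContinuous u‖ ^ 2 - S ^ 2 / W := by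
    have : ∀ x, (‖u x‖ - S / W) ^ 2 = ‖u x‖ ^ 2 - (2 * (S / W)) * ‖u x‖ + (S / W) ^ 2 :=
      fun x => by ring
    simp_rw [this]
    rw [integral_add (hi _ (by fun_prop)) (hi _ (by fun_prop)),
      integral_sub (hi _ (by fun_prop)) (hi _ (by fun_prop)), integral_const_mul, ← hS, ← hN,
      integral_const, ← hW, smul_eq_mul]
    field_simp
    ring
  rw [h1, sub_nonneg, div_le_iff₀ hWpos] at h0
  apply le_of_sq_le_sq _ (by positivity)
  rw [mul_pow, Real.sq_sqrt hWpos.le]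
  linarith

theorem continuous_comp_add (u : C(Torus, EuclideanSpace ℝ (Fin 2))) :
    Continuous fun r : ℝ × ℝ => u.comp ⟨(· + torusMk r), by fun_prop⟩ := by
  refine ContinuousMap.continuous_of_continuous_uncurry _ ?_
  have := continuous_torusMk
  change Continuous fun q : (ℝ × ℝ) × Torus => u (q.2 + torusMk q.1)
  fun_prop

theorem integrableOn_smul_comp (ρ : C(ℝ × ℝ, ℝ)) (u : C(Torus, EuclideanSpace ℝ (Fin 2))) :
    IntegrableOn (fun r => ρ r • u.comp ⟨(· + torusMk r), by fun_prop⟩) square :=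
  integrableOn_square (ρ.continuous.smul (continuous_comp_add u))

theorem continuous_translate (u : TorusL2) :
    Continuous fun r : ℝ × ℝ => translate (torusMk r) u := by
  have hc : Continuous fun r : ℝ × ℝ => (⟨(· + torusMk r), by fun_prop⟩ : C(Torus, Torus)) := by
    refine ContinuousMap.continuous_of_continuous_uncurry _ ?_
    have := continuous_torusMk
    change Continuous fun q : (ℝ × ℝ) × Torus => q.2 + torusMk q.1
    fun_prop
  exact Continuous.compMeasurePreservingLp (continuous_const (y := u)) hc
    (fun r => measurePreserving_add_right volume (torusMk r)) (by simp)

/-- Weighted average of the translates of a continuous vector field. -/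
noncomputable def avgContinuous (ρ : C(ℝ × ℝ, ℝ)) :
    C(Torus, EuclideanSpace ℝ (Fin 2)) →ₗ[ℝ] C(Torus, EuclideanSpace ℝ (Fin 2)) where
  toFun u := ∫ r in square, ρ r • u.comp ⟨(· + torusMk r), by fun_prop⟩
  map_add' u v := by
    rw [← integral_add (integrableOn_smul_comp ρ u) (integrableOn_smul_comp ρ v)]
    congr 1 with r
    simp
  map_smul' c u := by
    rw [RingHom.id_apply, ← integral_smul]
    congr 1 with r
    simp [mul_left_comm]

theorem avgContinuous_apply (ρ : C(ℝ × ℝ, ℝ)) (u : C(Torus, EuclideanSpace ℝ (Fin 2)))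
    (x : Torus) : avgContinuous ρ u x = ∫ r in square, ρ r • u (x + torusMk r) :=
  ContinuousMap.integral_apply (integrableOn_smul_comp ρ u) x

theorem exists_bound_on_square (ρ : C(ℝ × ℝ, ℝ)) : ∃ C, 0 ≤ C ∧ ∀ r ∈ square, ‖ρ r‖ ≤ C := by
  obtain ⟨C, hC⟩ := (isCompact_Icc.prod isCompact_Icc :
    IsCompact (Set.Icc 0 (2 * π) ×ˢ Set.Icc 0 (2 * π))).exists_bound_of_continuousOn
      ρ.continuous.continuousOn
  refine ⟨|C|, abs_nonneg C, fun r hr => (hC r ?_).trans (le_abs_self C)⟩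
  exact Set.prod_mono Set.Ioc_subset_Icc_self Set.Ioc_subset_Icc_self hr

theorem measurableSet_square : MeasurableSet square :=
  measurableSet_Ioc.prod measurableSet_Ioc

theorem exists_norm_avgContinuous_le (ρ : C(ℝ × ℝ, ℝ)) :
    ∃ C, ∀ u, ‖avgContinuous ρ u‖ ≤ C * ‖ofContinuous u‖ := by
  obtain ⟨C, hC0, hC⟩ := exists_bound_on_square ρ
  refine ⟨C * √(volume.real (Set.univ : Set Torus)), fun u => ?_⟩
  rw [ContinuousMap.norm_le _ (by positivity)]
  intro x
  have hcont : Continuous fun r => u (x + torusMk r) := by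
    have := continuous_torusMk
    fun_prop
  calc ‖avgContinuous ρ u x‖ = ‖∫ r in square, ρ r • u (x + torusMk r)‖ := by
        rw [avgContinuous_apply]
    _ ≤ ∫ r in square, C * ‖u (x + torusMk r)‖ := by
        refine norm_integral_le_of_norm_le
          (integrableOn_square (continuous_const.mul hcont.norm)) ?_
        refine (ae_restrict_iff' measurableSet_square).2 (.of_forall fun r hr => ?_)
        rw [norm_smul]
        gcongr
        exact hC r hr
    _ = C * ∫ y : Torus, ‖u (x + y)‖ := by
        rw [integral_const_mul, ← measurePreserving_torusMk.map_eq,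
          integral_map measurePreserving_torusMk.measurable.aemeasurable]
        exact Continuous.aestronglyMeasurable (by fun_prop)
    _ = C * ∫ y : Torus, ‖u y‖ := by
        rw [integral_add_left_eq_self (fun y => ‖u y‖) x]
    _ ≤ _ := by
        rw [mul_assoc]
        gcongr
        exact integral_norm_le u

/-- Weighted averages of translates of a square-integrable vector field are continuous. -/
noncomputable def avg (ρ : C(ℝ × ℝ, ℝ)) :
    TorusL2 →L[ℝ] C(Torus, EuclideanSpace ℝ (Fin 2)) :=
  (avgContinuous ρ).extendOfNorm ofContinuous.toLinearMap

theorem avg_ofContinuous (ρ : C(ℝ × ℝ, ℝ)) (u : C(Torus, EuclideanSpace ℝ (Fin 2))) :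
    avg ρ (ofContinuous u) = avgContinuous ρ u :=
  LinearMap.extendOfNorm_eq denseRange_ofContinuous (exists_norm_avgContinuous_le ρ) u

theorem ofContinuous_avg (ρ : C(ℝ × ℝ, ℝ)) (u : TorusL2) :
    ofContinuous (avg ρ u) = ∫ r in square, ρ r • translate (torusMk r) u := by
  refine denseRange_ofContinuous.induction_on u (isClosed_eq (by fun_prop) ?_) fun f => ?_
  · obtain ⟨C, hC0, hC⟩ := exists_bound_on_square ρ
    refine continuous_iff_continuousAt.2 fun u₀ =>
      continuousAt_of_dominated (bound := fun _ => C * (‖u₀‖ + 1)) ?_ ?_ ?_ ?_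
    · exact .of_forall fun w =>
        (ρ.continuous.smul (continuous_translate w)).aestronglyMeasurable
    · filter_upwards [Metric.ball_mem_nhds u₀ one_pos] with w hw
      refine (ae_restrict_iff' measurableSet_square).2 (.of_forall fun r hr => ?_)
      rw [norm_smul, LinearIsometry.norm_map]
      have : ‖w‖ ≤ ‖u₀‖ + 1 := by
        have := norm_le_norm_add_norm_sub' w u₀
        rw [mem_ball_iff_norm] at hw
        linarith
      gcongr
      exact hC r hr
    · exact integrableOn_square continuous_const
    · exact .of_forall fun r => by fun_prop
  · rw [avg_ofContinuous]
    change ofContinuous (∫ r in square, ρ r • f.comp ⟨(· + torusMk r), by fun_prop⟩) = _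
    rw [← ContinuousLinearMap.integral_comp_comm _ (integrableOn_smul_comp ρ f)]
    congr 1 with r

end TorusL2

theorem intervalIntegral_add_sub_smul_deriv {X : Type*} [NormedAddCommGroup X] [NormedSpace ℝ X]
    [CompleteSpace X] {φ φ' : ℝ → X} (h : ∀ t, HasDerivAt φ (φ' t) t) (hφ' : Continuous φ')
    (L : ℝ) : ∫ t in (0)..L, (φ t + (t - L) • φ' t) = L • φ 0 := by
  have hφ : Continuous φ := continuous_iff_continuousAt.2 fun t => (h t).continuousAt
  have hd : ∀ t ∈ Set.uIcc 0 L, HasDerivAt (fun t => (t - L) • φ t) (φ t + (t - L) • φ' t) t := by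
    intro t _
    have := ((hasDerivAt_id t).sub_const L).smul (h t)
    exact this.congr_deriv (by simp [add_comm])
  rw [intervalIntegral.integral_eq_sub_of_hasDerivAt hd
    (Continuous.intervalIntegrable (by fun_prop) _ _)]
  simp

section

variable {X : Type*} [NormedAddCommGroup X] [NormedSpace ℝ X]

/-- Derivative of a map in a fixed direction. -/
noncomputable def dirDeriv (e : Fin 3 → ℝ) (v : (Fin 3 → ℝ) → X) (p : Fin 3 → ℝ) : X :=
  fderiv ℝ v p e

theorem contDiff_dirDeriv {v : (Fin 3 → ℝ) → X} (hv : ContDiff ℝ (⊤ : ℕ∞) v) (e : Fin 3 → ℝ) :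
    ContDiff ℝ (⊤ : ℕ∞) (dirDeriv e v) :=
  (hv.fderiv_right (m := (⊤ : ℕ∞)) (by simp)).clm_apply contDiff_const

theorem hasDerivAt_dirDeriv {v : (Fin 3 → ℝ) → X} (hv : ContDiff ℝ (⊤ : ℕ∞) v) {e : Fin 3 → ℝ}
    {γ : ℝ → Fin 3 → ℝ} {t : ℝ} (hγ : HasDerivAt γ e t) :
    HasDerivAt (fun t => v (γ t)) (dirDeriv e v (γ t)) t :=
  ((hv.differentiable (by simp) (γ t)).hasFDerivAt).comp_hasDerivAt t hγ

theorem hasDerivAt_torusShift_left (p : Fin 3 → ℝ) (s t : ℝ) :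
    HasDerivAt (fun s => p + torusShift (s, t)) (Pi.single 0 1) s := by
  refine HasDerivAt.const_add _ (hasDerivAt_pi.2 fun i => ?_)
  fin_cases i
  · simpa [torusShift] using hasDerivAt_id' s
  · simpa [torusShift] using hasDerivAt_const s t
  · simpa [torusShift] using hasDerivAt_const s (0 : ℝ)

theorem hasDerivAt_torusShift_right (p : Fin 3 → ℝ) (s t : ℝ) :
    HasDerivAt (fun t => p + torusShift (s, t)) (Pi.single 1 1) t := by
  refine HasDerivAt.const_add _ (hasDerivAt_pi.2 fun i => ?_)
  fin_cases i
  · simpa [torusShift] using hasDerivAt_const t s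
  · simpa [torusShift] using hasDerivAt_id' t
  · simpa [torusShift] using hasDerivAt_const t (0 : ℝ)

theorem continuous_comp_add_torusShift {v : (Fin 3 → ℝ) → X} (hv : ContDiff ℝ (⊤ : ℕ∞) v)
    (p : Fin 3 → ℝ) : Continuous fun r => v (p + torusShift r) :=
  hv.continuous.comp (continuous_const.add continuous_torusShift)

theorem smul_eq_integral_square [CompleteSpace X] {v : (Fin 3 → ℝ) → X}
    (hv : ContDiff ℝ (⊤ : ℕ∞) v) (p : Fin 3 → ℝ) :
    (2 * π) • (2 * π) • v p = ∫ r in TorusL2.square,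
      (v (p + torusShift r)
        + (r.1 - 2 * π) • dirDeriv (Pi.single 0 1) v (p + torusShift r)
        + (r.2 - 2 * π) • dirDeriv (Pi.single 1 1) v (p + torusShift r)
        + ((r.1 - 2 * π) * (r.2 - 2 * π)) •
          dirDeriv (Pi.single 1 1) (dirDeriv (Pi.single 0 1) v) (p + torusShift r)) := by
  have hv0 := contDiff_dirDeriv hv (Pi.single 0 1)
  have hv1 := contDiff_dirDeriv hv (Pi.single 1 1)
  have hv01 := contDiff_dirDeriv hv0 (Pi.single 1 1)
  have c := hv.continuous
  have d := hv0.continuous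
  have d1 := hv1.continuous
  have d01 := hv01.continuous
  set L := 2 * π with hL
  have hL0 : 0 ≤ L := by positivity
  rw [TorusL2.square, Measure.volume_eq_prod, setIntegral_prod]
  swap
  · rw [← Measure.volume_eq_prod]
    exact TorusL2.integrableOn_square (by fun_prop)
  rw [← hL, ← intervalIntegral.integral_of_le hL0]
  have inner : ∀ s : ℝ, ∫ t in Set.Ioc 0 L, (v (p + torusShift (s, t))
        + (s - L) • dirDeriv (Pi.single 0 1) v (p + torusShift (s, t))
        + (t - L) • dirDeriv (Pi.single 1 1) v (p + torusShift (s, t))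
        + ((s - L) * (t - L)) •
          dirDeriv (Pi.single 1 1) (dirDeriv (Pi.single 0 1) v) (p + torusShift (s, t))) =
      L • (v (p + torusShift (s, 0))
        + (s - L) • dirDeriv (Pi.single 0 1) v (p + torusShift (s, 0))) := by
    intro s
    have hd : ∀ t, HasDerivAt (fun t => v (p + torusShift (s, t))
        + (s - L) • dirDeriv (Pi.single 0 1) v (p + torusShift (s, t)))
        (dirDeriv (Pi.single 1 1) v (p + torusShift (s, t)) + (s - L) •
          dirDeriv (Pi.single 1 1) (dirDeriv (Pi.single 0 1) v) (p + torusShift (s, t))) t :=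
      fun t => (hasDerivAt_dirDeriv hv (hasDerivAt_torusShift_right p s t)).add
        ((hasDerivAt_dirDeriv hv0 (hasDerivAt_torusShift_right p s t)).const_smul (s - L))
    have c1' : Continuous fun t => dirDeriv (Pi.single 1 1) v (p + torusShift (s, t)) :=
      (continuous_comp_add_torusShift hv1 p).comp (Continuous.prodMk_right s)
    have c01' : Continuous fun t =>
        dirDeriv (Pi.single 1 1) (dirDeriv (Pi.single 0 1) v) (p + torusShift (s, t)) :=
      (continuous_comp_add_torusShift hv01 p).comp (Continuous.prodMk_right s)
    rw [← intervalIntegral_add_sub_smul_deriv hd (c1'.add (c01'.const_smul _)) L,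
      ← intervalIntegral.integral_of_le hL0]
    congr 1 with t
    module
  simp_rw [inner]
  rw [intervalIntegral.integral_smul, intervalIntegral_add_sub_smul_deriv
    (fun s => hasDerivAt_dirDeriv hv (hasDerivAt_torusShift_left p s 0))
    ((continuous_comp_add_torusShift hv0 p).comp (Continuous.prodMk_left 0))]
  congr 4
  ext i; fin_cases i <;> simp [torusShift]

end

namespace TorusL2

/-- Families of vector fields on the torus that commute with translations. -/
def Equivariant (v : (Fin 3 → ℝ) → TorusL2) : Prop :=
  ∀ p a, v (p + torusShift a) = translate (torusMk a) (v p)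

theorem Equivariant.dirDeriv {v : (Fin 3 → ℝ) → TorusL2} (hv : Equivariant v)
    (hd : ContDiff ℝ (⊤ : ℕ∞) v) (e : Fin 3 → ℝ) : Equivariant (dirDeriv e v) := by
  intro p a
  have h : (fun q => v (q + torusShift a)) =
      fun q => (translate (torusMk a)).toContinuousLinearMap (v q) := funext fun q => hv q a
  have h1 : HasFDerivAt (fun q => v (q + torusShift a)) (fderiv ℝ v (p + torusShift a)) p := by
    have := (hd.differentiable (by simp) (p + torusShift a)).hasFDerivAt
    exact (hasFDerivAt_comp_add_right _).2 this
  rw [h] at h1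
  have h2 := ((translate (torusMk a)).toContinuousLinearMap.hasFDerivAt (x := v p)).comp p
    (hd.differentiable (by simp) p).hasFDerivAt
  exact congrArg (fun A => A e) (h1.unique h2)

theorem Equivariant.ofContinuous_avg {v : (Fin 3 → ℝ) → TorusL2} (hv : Equivariant v)
    (ρ : C(ℝ × ℝ, ℝ)) (p : Fin 3 → ℝ) :
    ofContinuous (avg ρ (v p)) = ∫ r in square, ρ r • v (p + torusShift r) := by
  rw [TorusL2.ofContinuous_avg]
  simp_rw [hv p]

theorem Equivariant.exists_eq_ofContinuous {v : (Fin 3 → ℝ) → TorusL2} (hv : Equivariant v)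
    (hd : ContDiff ℝ (⊤ : ℕ∞) v) :
    ∃ F : (Fin 3 → ℝ) → C(Torus, EuclideanSpace ℝ (Fin 2)), ContDiff ℝ (⊤ : ℕ∞) F ∧
      ∀ p, v p = ofContinuous (F p) := by
  have hd0 := contDiff_dirDeriv hd (Pi.single 0 1)
  have hd1 := contDiff_dirDeriv hd (Pi.single 1 1)
  have hd01 := contDiff_dirDeriv hd0 (Pi.single 1 1)
  have hv0 := hv.dirDeriv hd (Pi.single 0 1)
  have hv1 := hv.dirDeriv hd (Pi.single 1 1)
  have hv01 := hv0.dirDeriv hd0 (Pi.single 1 1)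
  refine ⟨fun p => (2 * π)⁻¹ • (2 * π)⁻¹ • (avg 1 (v p)
      + avg ⟨fun r => r.1 - 2 * π, by fun_prop⟩ (_root_.dirDeriv (Pi.single 0 1) v p)
      + avg ⟨fun r => r.2 - 2 * π, by fun_prop⟩ (_root_.dirDeriv (Pi.single 1 1) v p)
      + avg ⟨fun r => (r.1 - 2 * π) * (r.2 - 2 * π), by fun_prop⟩
          (_root_.dirDeriv (Pi.single 1 1) (_root_.dirDeriv (Pi.single 0 1) v) p)), ?_,
      fun p => ?_⟩
  · exact (((((avg _).contDiff.comp hd).add ((avg _).contDiff.comp hd0)).add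
      ((avg _).contDiff.comp hd1)).add ((avg _).contDiff.comp hd01)).const_smul _ |>.const_smul _
  · have hpi : 2 * π ≠ 0 := by positivity
    have c := hd.continuous
    have c0 := hd0.continuous
    have c1 := hd1.continuous
    have c01 := hd01.continuous
    rw [map_smul, map_smul, map_add, map_add, map_add, hv.ofContinuous_avg,
      hv0.ofContinuous_avg, hv1.ofContinuous_avg, hv01.ofContinuous_avg,
      ← integral_add (integrableOn_square (by fun_prop))
        (integrableOn_square (by simp only [ContinuousMap.coe_mk]; fun_prop)),
      ← integral_add (integrableOn_square (by simp only [ContinuousMap.coe_mk]; fun_prop))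
        (integrableOn_square (by simp only [ContinuousMap.coe_mk]; fun_prop)),
      ← integral_add (integrableOn_square (by simp only [ContinuousMap.coe_mk]; fun_prop))
        (integrableOn_square (by simp only [ContinuousMap.coe_mk]; fun_prop)),
      eq_inv_smul_iff₀ hpi, eq_inv_smul_iff₀ hpi, smul_eq_integral_square hd]
    simp

/-- A smooth equivariant family of vector fields comes from a smooth periodic function. -/
theorem Equivariant.exists_smoothPeriodic {v : (Fin 3 → ℝ) → TorusL2} (hv : Equivariant v)
    (hd : ContDiff ℝ (⊤ : ℕ∞) v) :
    ∃ (f : (Fin 3 → ℝ) → EuclideanSpace ℝ (Fin 2)) (hf : SmoothPeriodic f),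
      ∀ p, v p = ofContinuous (hf.onTorus p) := by
  obtain ⟨F, hF, hvF⟩ := hv.exists_eq_ofContinuous hd
  have key : ∀ p a x, F (p + torusShift a) x = F p (x + torusMk a) := by
    intro p a x
    have := hv p a
    rw [hvF, hvF, translate_ofContinuous] at this
    exact congrArg (fun g => g x) (ofContinuous_injective this)
  have hper : ∀ a, torusMk a = 0 → ∀ p, F (p + torusShift a) = F p := by
    intro a ha p
    ext1 x
    rw [key, ha, add_zero]
  have e0 : torusShift (2 * π, 0) = Pi.single 0 (2 * π) := by
    ext i; fin_cases i <;> simp [torusShift]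
  have e1 : torusShift (0, 2 * π) = Pi.single 1 (2 * π) := by
    ext i; fin_cases i <;> simp [torusShift]
  have hf : SmoothPeriodic fun p => F p 0 := by
    refine ⟨ContDiff.comp (g := ContinuousMap.evalCLM ℝ (0 : Torus))
      (ContinuousLinearMap.contDiff _) hF, fun p => ?_, fun p => ?_⟩
    · rw [← e0, hper]
      simp [torusMk, Prod.ext_iff, AddCircle.coe_period]
    · rw [← e1, hper]
      simp [torusMk, Prod.ext_iff, AddCircle.coe_period]
  refine ⟨_, hf, fun p => ?_⟩
  rw [hvF]
  congr 1
  ext1 x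
  obtain ⟨a, rfl⟩ := isOpenQuotientMap_torusMk.surjective x
  rw [hf.onTorus_torusMk, key, zero_add]

end TorusL2

namespace SmoothPeriodic

section

variable {F F' : Type*} [NormedAddCommGroup F] [NormedSpace ℝ F] [NormedAddCommGroup F']
  [NormedSpace ℝ F'] {g : (Fin 3 → ℝ) → F} {g' : (Fin 3 → ℝ) → F'}

theorem map (hg : SmoothPeriodic g) {h : F → F'} (hh : ContDiff ℝ (⊤ : ℕ∞) h) :
    SmoothPeriodic fun p => h (g p) where
  contDiff := hh.comp hg.contDiff
  periodic₀ p := congrArg h (hg.periodic₀ p)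
  periodic₁ p := congrArg h (hg.periodic₁ p)

theorem prodMk (hg : SmoothPeriodic g) (hg' : SmoothPeriodic g') :
    SmoothPeriodic fun p => (g p, g' p) where
  contDiff := hg.contDiff.prodMk hg'.contDiff
  periodic₀ p := Prod.ext (hg.periodic₀ p) (hg'.periodic₀ p)
  periodic₁ p := Prod.ext (hg.periodic₁ p) (hg'.periodic₁ p)

theorem const (c : F) : SmoothPeriodic fun _ : Fin 3 → ℝ => c :=
  ⟨contDiff_const, fun _ => rfl, fun _ => rfl⟩

theorem add {k : (Fin 3 → ℝ) → F} (hg : SmoothPeriodic g) (hk : SmoothPeriodic k) :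
    SmoothPeriodic fun p => g p + k p :=
  (hg.prodMk hk).map contDiff_add

theorem smul {k : (Fin 3 → ℝ) → ℝ} (hk : SmoothPeriodic k) (hg : SmoothPeriodic g) :
    SmoothPeriodic fun p => k p • g p :=
  (hk.prodMk hg).map contDiff_smul

theorem mul {g k : (Fin 3 → ℝ) → ℝ} (hg : SmoothPeriodic g) (hk : SmoothPeriodic k) :
    SmoothPeriodic fun p => g p * k p :=
  hg.smul hk

theorem clm_apply {A : (Fin 3 → ℝ) → F →L[ℝ] F'} (hA : SmoothPeriodic A)
    (hg : SmoothPeriodic g) : SmoothPeriodic fun p => A p (g p) :=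
  (hA.prodMk hg).map isBoundedBilinearMap_apply.contDiff

theorem dirDeriv (hg : SmoothPeriodic g) (e : Fin 3 → ℝ) : SmoothPeriodic (dirDeriv e g) :=
  hg.fderiv.clm_apply (const e)

theorem comp_add_left (hg : SmoothPeriodic g) (q : Fin 3 → ℝ) :
    SmoothPeriodic fun p => g (q + p) where
  contDiff := hg.contDiff.comp (contDiff_const.add contDiff_id)
  periodic₀ p := by rw [← add_assoc, hg.periodic₀]
  periodic₁ p := by rw [← add_assoc, hg.periodic₁]

theorem onTorus_comp_add_left (hg : SmoothPeriodic g) (q p : Fin 3 → ℝ) :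
    (hg.comp_add_left q).onTorus p = hg.onTorus (q + p) := by
  ext x
  simp [onTorus, add_assoc]

theorem apply_zero_eq_of_onTorus {c : F} (hg : SmoothPeriodic g)
    (h : ∀ x, hg.onTorus 0 x = c) : g 0 = c := by
  have := h (torusMk 0)
  rw [onTorus_torusMk] at this
  rw [← this]
  congr 1
  ext i; fin_cases i <;> simp [torusShift]

theorem proj {n : ℕ} {g : (Fin 3 → ℝ) → EuclideanSpace ℝ (Fin n)} (hg : SmoothPeriodic g)
    (i : Fin n) : SmoothPeriodic fun p => g p i :=
  hg.map (h := fun v => v i) (EuclideanSpace.proj (𝕜 := ℝ) i).contDiff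

theorem vec2 {a b : (Fin 3 → ℝ) → ℝ} (ha : SmoothPeriodic a) (hb : SmoothPeriodic b) :
    SmoothPeriodic fun p => !₂[a p, b p] where
  contDiff := by
    rw [contDiff_euclidean]
    intro i
    fin_cases i
    exacts [ha.contDiff, hb.contDiff]
  periodic₀ p := by rw [ha.periodic₀, hb.periodic₀]
  periodic₁ p := by rw [ha.periodic₁, hb.periodic₁]

end

/-- The derivative of `g` in the first two coordinate directions. -/
noncomputable def _root_.torusGrad (g : (Fin 3 → ℝ) → ℝ) (p : Fin 3 → ℝ) :
    EuclideanSpace ℝ (Fin 2) :=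
  !₂[_root_.dirDeriv (Pi.single 0 1) g p, _root_.dirDeriv (Pi.single 1 1) g p]

theorem torusGrad {g : (Fin 3 → ℝ) → ℝ} (hg : SmoothPeriodic g) :
    SmoothPeriodic (torusGrad g) :=
  (hg.dirDeriv _).vec2 (hg.dirDeriv _)

theorem _root_.Torus.integrable (g : C(Torus, ℝ)) : Integrable g :=
  g.continuous.integrable_of_hasCompactSupport (.of_compactSpace _)

/-- Integration over the torus. -/
noncomputable def _root_.Torus.integralCLM : C(Torus, ℝ) →L[ℝ] ℝ :=
  LinearMap.mkContinuous
    { toFun := fun g => ∫ x, g x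
      map_add' := fun g k => integral_add (Torus.integrable g) (Torus.integrable k)
      map_smul' := fun c g => integral_smul c g }
    ((volume : Measure Torus).real Set.univ) fun g => by
      refine le_of_le_of_eq ?_ (mul_comm _ _)
      exact norm_integral_le_of_norm_le_const (.of_forall g.norm_coe_le_norm)

theorem integral_dirDeriv_torusShift {g : (Fin 3 → ℝ) → ℝ} (hg : SmoothPeriodic g)
    (p : Fin 3 → ℝ) (a : ℝ × ℝ) : ∫ x, (hg.dirDeriv (torusShift a)).onTorus p x = 0 := by
  have hγ : HasDerivAt (fun s : ℝ => p + torusShift (s • a)) (torusShift a) 0 := by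
    refine HasDerivAt.const_add _ (hasDerivAt_pi.2 fun i => ?_)
    fin_cases i
    · simpa [torusShift] using (hasDerivAt_id' (0 : ℝ)).mul_const a.1
    · simpa [torusShift] using (hasDerivAt_id' (0 : ℝ)).mul_const a.2
    · simpa [torusShift] using hasDerivAt_const (0 : ℝ) (0 : ℝ)
  have hp : p + torusShift ((0 : ℝ) • a) = p := by
    ext i; fin_cases i <;> simp [torusShift]
  have h1 := hg.hasFDerivAt_onTorus p
  rw [← hp] at h1
  have h2 := (Torus.integralCLM.hasFDerivAt.comp _ h1).comp_hasDerivAt 0 hγ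
  have h3 : (Torus.integralCLM ∘ hg.onTorus) ∘ (fun s : ℝ => p + torusShift (s • a)) =
      fun _ => Torus.integralCLM (hg.onTorus p) := by
    ext s
    change ∫ x, hg.onTorus (p + torusShift (s • a)) x = ∫ x, hg.onTorus p x
    simp_rw [onTorus_add]
    exact integral_add_right_eq_self (fun x => hg.onTorus p x) _
  rw [h3, hp] at h2
  exact h2.unique (hasDerivAt_const _ _)

theorem integral_dirDeriv_zero {g : (Fin 3 → ℝ) → ℝ} (hg : SmoothPeriodic g)
    (p : Fin 3 → ℝ) : ∫ x, (hg.dirDeriv (Pi.single 0 1)).onTorus p x = 0 := by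
  have e : torusShift (1, 0) = Pi.single 0 1 := by
    ext i; fin_cases i <;> simp [torusShift]
  simpa only [e] using hg.integral_dirDeriv_torusShift p (1, 0)

theorem integral_dirDeriv_one {g : (Fin 3 → ℝ) → ℝ} (hg : SmoothPeriodic g)
    (p : Fin 3 → ℝ) : ∫ x, (hg.dirDeriv (Pi.single 1 1)).onTorus p x = 0 := by
  have e : torusShift (0, 1) = Pi.single 1 1 := by
    ext i; fin_cases i <;> simp [torusShift]
  simpa only [e] using hg.integral_dirDeriv_torusShift p (0, 1)

theorem _root_.dirDeriv_mul {g k : (Fin 3 → ℝ) → ℝ} (hg : ContDiff ℝ (⊤ : ℕ∞) g)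
    (hk : ContDiff ℝ (⊤ : ℕ∞) k) (e p : Fin 3 → ℝ) :
    _root_.dirDeriv e (fun p => g p * k p) p =
      g p * _root_.dirDeriv e k p + k p * _root_.dirDeriv e g p := by
  rw [_root_.dirDeriv, fderiv_fun_mul (hg.differentiable (by simp) p)
    (hk.differentiable (by simp) p)]
  simp [_root_.dirDeriv]

theorem integral_add_onTorus {g k l : (Fin 3 → ℝ) → ℝ} (hg : SmoothPeriodic g)
    (hk : SmoothPeriodic k) (hl : SmoothPeriodic l) (h : ∀ p, l p = g p + k p) (p : Fin 3 → ℝ) :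
    ∫ x, hl.onTorus p x = (∫ x, hg.onTorus p x) + ∫ x, hk.onTorus p x := by
  rw [← integral_add (Torus.integrable _) (Torus.integrable _)]
  congr 1 with x
  exact h _

/-- A periodic field that is orthogonal to gradients on the torus through `0`
is divergence free at `0`. -/
theorem divergence_eq_zero {P : (Fin 3 → ℝ) → EuclideanSpace ℝ (Fin 2)} (hP : SmoothPeriodic P)
    (h : ∀ (η : (Fin 3 → ℝ) → ℝ) (hη : SmoothPeriodic η),
      ∫ x, inner ℝ (hP.onTorus 0 x) (hη.torusGrad.onTorus 0 x) = 0) :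
    _root_.dirDeriv (Pi.single 0 1) (fun p => P p 0) 0 +
      _root_.dirDeriv (Pi.single 1 1) (fun p => P p 1) 0 = 0 := by
  set η : (Fin 3 → ℝ) → ℝ := fun p => _root_.dirDeriv (Pi.single 0 1) (fun p => P p 0) p +
      _root_.dirDeriv (Pi.single 1 1) (fun p => P p 1) p with hη_def
  have hη : SmoothPeriodic η := ((hP.proj 0).dirDeriv _).add ((hP.proj 1).dirDeriv _)
  have hI : SmoothPeriodic fun p => inner ℝ (P p) (_root_.torusGrad η p) :=
    (hP.prodMk hη.torusGrad).map contDiff_inner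
  have hsq : SmoothPeriodic fun p => η p * η p := hη.mul hη
  have hD0 := ((hP.proj 0).mul hη).dirDeriv (Pi.single 0 1)
  have hD1 := ((hP.proj 1).mul hη).dirDeriv (Pi.single 1 1)
  have e1 := integral_add_onTorus hD0 hD1 (hI.add hsq) (fun p => by
    rw [dirDeriv_mul (hP.proj 0).contDiff hη.contDiff,
      dirDeriv_mul (hP.proj 1).contDiff hη.contDiff]
    simp only [_root_.torusGrad, PiLp.inner_apply, Fin.sum_univ_two, hη_def]
    simp
    ring) 0
  have e2 := integral_add_onTorus hI hsq (hI.add hsq) (fun _ => rfl) 0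
  rw [integral_dirDeriv_zero ((hP.proj 0).mul hη), integral_dirDeriv_one ((hP.proj 1).mul hη)] at e1
  have e3 : ∫ x, hI.onTorus 0 x = 0 := h η hη
  rw [e1, e3, add_zero, zero_add] at e2
  have e4 := ((hsq.onTorus 0).continuous.ae_eq_iff_eq volume continuous_const).1
    ((integral_eq_zero_iff_of_nonneg (f := hsq.onTorus 0) (fun x => mul_self_nonneg _)
      (Torus.integrable _)).1 e2.symm)
  have e5 := hsq.apply_zero_eq_of_onTorus (c := 0) (fun x => congrFun e4 x)
  exact mul_self_eq_zero.1 e5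

end SmoothPeriodic

namespace TorusL2

/-- The closure of the gradients of smooth functions on the torus. -/
noncomputable def gradSpace : Submodule ℝ TorusL2 :=
  (Submodule.span ℝ {u | ∃ (η : (Fin 3 → ℝ) → ℝ) (hη : SmoothPeriodic η),
    u = ofContinuous (hη.torusGrad.onTorus 0)}).topologicalClosure

instance : CompleteSpace gradSpace :=
  (Submodule.isClosed_topologicalClosure _).completeSpace_coe

theorem ofContinuous_torusGrad_mem {η : (Fin 3 → ℝ) → ℝ} (hη : SmoothPeriodic η) :
    ofContinuous (hη.torusGrad.onTorus 0) ∈ gradSpace :=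
  Submodule.le_topologicalClosure _ (Submodule.subset_span ⟨η, hη, rfl⟩)

theorem gradSpace_le {W : Submodule ℝ TorusL2} (hW : IsClosed (W : Set TorusL2))
    (h : ∀ (η : (Fin 3 → ℝ) → ℝ) (hη : SmoothPeriodic η),
      ofContinuous (hη.torusGrad.onTorus 0) ∈ W) : gradSpace ≤ W := by
  refine Submodule.topologicalClosure_minimal _ (Submodule.span_le.2 ?_) hW
  rintro _ ⟨η, hη, rfl⟩
  exact h η hη

theorem inner_eq_zero_of_mem_gradSpace {u v : TorusL2} (hu : u ∈ gradSpace)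
    (h : ∀ (η : (Fin 3 → ℝ) → ℝ) (hη : SmoothPeriodic η),
      inner ℝ v (ofContinuous (hη.torusGrad.onTorus 0)) = 0) : inner ℝ v u = 0 := by
  have := gradSpace_le (W := (Submodule.span ℝ {v})ᗮ) (Submodule.isClosed_orthogonal _)
    (fun η hη => (Submodule.mem_orthogonal_singleton_iff_inner_right).2 (h η hη))
  exact Submodule.mem_orthogonal_singleton_iff_inner_right.1 (this hu)

theorem torusGrad_comp_add_left {η : (Fin 3 → ℝ) → ℝ} (q p : Fin 3 → ℝ) :
    torusGrad (fun p => η (q + p)) p = torusGrad η (q + p) := by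
  simp only [torusGrad, dirDeriv, fderiv_comp_add_left]

theorem translate_mem_gradSpace (a : ℝ × ℝ) {u : TorusL2} (hu : u ∈ gradSpace) :
    translate (torusMk a) u ∈ gradSpace := by
  refine gradSpace_le (W := gradSpace.comap (translate (torusMk a)).toLinearMap)
    ((Submodule.isClosed_topologicalClosure _).preimage (translate (torusMk a)).continuous)
    (fun η hη => ?_) hu
  have : translate (torusMk a) (ofContinuous (hη.torusGrad.onTorus 0)) =
      ofContinuous ((hη.comp_add_left (torusShift a)).torusGrad.onTorus 0) := by
    rw [translate_ofContinuous]
    congr 1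
    ext1 x
    change hη.torusGrad.onTorus 0 (x + torusMk a) = _
    rw [← SmoothPeriodic.onTorus_add, zero_add]
    change torusGrad η _ = torusGrad _ _
    rw [torusGrad_comp_add_left, zero_add]
  change translate (torusMk a) (ofContinuous (hη.torusGrad.onTorus 0)) ∈ gradSpace
  rw [this]
  exact ofContinuous_torusGrad_mem (hη.comp_add_left (torusShift a))

theorem translate_zero (u : TorusL2) : translate 0 u = u := by
  refine denseRange_ofContinuous.induction_on u
    (isClosed_eq (translate 0).continuous continuous_id) fun f => ?_
  rw [translate_ofContinuous]
  congr 1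
  ext1 x
  simp

theorem translate_translate (r s : Torus) (u : TorusL2) :
    translate r (translate s u) = translate (r + s) u := by
  refine denseRange_ofContinuous.induction_on u
    (isClosed_eq ((translate r).continuous.comp (translate s).continuous)
      (translate (r + s)).continuous) fun f => ?_
  rw [translate_ofContinuous, translate_ofContinuous, translate_ofContinuous]
  congr 1
  ext1 x
  simp [add_assoc]

theorem exists_coercive_bound
    (A : C(Torus, EuclideanSpace ℝ (Fin 2) →L[ℝ] EuclideanSpace ℝ (Fin 2)))
    (hA : ∀ x v, v ≠ 0 → 0 < (inner ℝ (A x v) v : ℝ)) :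
    ∃ c > 0, ∀ x v, c * inner ℝ v v ≤ inner ℝ (A x v) v := by
  obtain ⟨⟨x₀, v₀⟩, h₀, hmin⟩ := (isCompact_univ.prod
    (isCompact_sphere (0 : EuclideanSpace ℝ (Fin 2)) 1)).exists_isMinOn
    (f := fun q : Torus × EuclideanSpace ℝ (Fin 2) => (inner ℝ (A q.1 q.2) q.2 : ℝ))
    (Set.univ_nonempty.prod ((NormedSpace.sphere_nonempty (E := EuclideanSpace ℝ (Fin 2))).2
      zero_le_one)) (Continuous.continuousOn (by fun_prop))
  have hv₀ : v₀ ≠ 0 := by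
    rintro rfl
    simpa using h₀.2
  refine ⟨_, hA x₀ v₀ hv₀, fun x v => ?_⟩
  by_cases hv : v = 0
  · simp [hv]
  have hn : ‖v‖ ≠ 0 := norm_ne_zero_iff.2 hv
  have h1 := isMinOn_iff.1 hmin (x, ‖v‖⁻¹ • v) ⟨trivial, by simp [norm_smul, hn]⟩
  simp only [map_smul, inner_smul_left, inner_smul_right] at h1
  have h2 : (inner ℝ v v : ℝ) = ‖v‖ ^ 2 := real_inner_self_eq_norm_sq v
  rw [h2]
  calc _ ≤ _ := mul_le_mul_of_nonneg_right h1 (sq_nonneg _)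
    _ = inner ℝ (A x v) v := by
      simp only [RCLike.conj_to_real]
      field_simp

/-- The compression of a multiplication operator to the space of gradients. -/
noncomputable def compression
    (A : C(Torus, EuclideanSpace ℝ (Fin 2) →L[ℝ] EuclideanSpace ℝ (Fin 2))) :
    gradSpace →L[ℝ] gradSpace :=
  (gradSpace.orthogonalProjectionOnto ∘L mulOp A) ∘L gradSpace.subtypeL

theorem contDiff_mulOp_onTorus
    {A : (Fin 3 → ℝ) → EuclideanSpace ℝ (Fin 2) →L[ℝ] EuclideanSpace ℝ (Fin 2)}
    (hA : SmoothPeriodic A) : ContDiff ℝ (⊤ : ℕ∞) fun p => mulOp (hA.onTorus p) :=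
  ContDiff.comp (g := mulOp) (ContinuousLinearMap.contDiff _) hA.contDiff_onTorus

theorem contDiff_compression
    {A : (Fin 3 → ℝ) → EuclideanSpace ℝ (Fin 2) →L[ℝ] EuclideanSpace ℝ (Fin 2)}
    (hA : SmoothPeriodic A) : ContDiff ℝ (⊤ : ℕ∞) fun p => compression (hA.onTorus p) :=
  (contDiff_const.clm_comp (contDiff_mulOp_onTorus hA)).clm_comp contDiff_const

theorem inner_compression
    (A : C(Torus, EuclideanSpace ℝ (Fin 2) →L[ℝ] EuclideanSpace ℝ (Fin 2)))
    (u w : gradSpace) :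
    inner ℝ (compression A u) w = inner ℝ (mulOp A (u : TorusL2)) (w : TorusL2) :=
  Submodule.inner_orthogonalProjectionOnto_eq_of_mem_right w (mulOp A (u : TorusL2))

theorem exists_equiv_compression
    (A : C(Torus, EuclideanSpace ℝ (Fin 2) →L[ℝ] EuclideanSpace ℝ (Fin 2)))
    (hA : ∀ x v, v ≠ 0 → 0 < (inner ℝ (A x v) v : ℝ)) :
    ∃ e : gradSpace ≃L[ℝ] gradSpace, (e : gradSpace →L[ℝ] gradSpace) = compression A := by
  obtain ⟨c, hc, h⟩ := exists_coercive_bound A hA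
  have hco : IsCoercive ((innerSL ℝ : gradSpace →L[ℝ] gradSpace →L[ℝ] ℝ).comp (compression A)) := by
    refine ⟨c, hc, fun u => ?_⟩
    have := le_inner_mulOp A c h u
    rw [← inner_compression, real_inner_self_eq_norm_sq] at this
    rw [mul_assoc, ← sq]
    exact this
  refine ⟨hco.continuousLinearEquivOfBilin, ?_⟩
  ext1 u
  refine (hco.unique_continuousLinearEquivOfBilin fun w => ?_).symm
  rfl

theorem exists_solution {A : (Fin 3 → ℝ) → EuclideanSpace ℝ (Fin 2) →L[ℝ] EuclideanSpace ℝ (Fin 2)}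
    (hA : SmoothPeriodic A) (hpos : ∀ p v, v ≠ 0 → 0 < (inner ℝ (A p v) v : ℝ))
    (k : EuclideanSpace ℝ (Fin 2)) :
    ∃ v : (Fin 3 → ℝ) → gradSpace, ContDiff ℝ (⊤ : ℕ∞) v ∧
      ∀ p (w : gradSpace), inner ℝ
        (mulOp (hA.onTorus p) (ofContinuous (ContinuousMap.const Torus k) + v p))
          (w : TorusL2) = 0 := by
  have hpos' : ∀ p x v, v ≠ 0 → 0 < (inner ℝ (hA.onTorus p x v) v : ℝ) := fun p x => hpos _
  choose e he using fun p => exists_equiv_compression (hA.onTorus p) (hpos' p)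
  set K := ofContinuous (ContinuousMap.const Torus k) with hK
  refine ⟨fun p => - (compression (hA.onTorus p)).inverse
    (gradSpace.orthogonalProjectionOnto (mulOp (hA.onTorus p) K)), ?_, fun p w => ?_⟩
  · rw [contDiff_iff_contDiffAt]
    intro p
    have h1 : ContDiffAt ℝ (⊤ : ℕ∞) (fun p => compression (hA.onTorus p)) p :=
      (contDiff_compression hA).contDiffAt
    have h2 : ContDiffAt ℝ (⊤ : ℕ∞) (ContinuousLinearMap.inverse (R := ℝ) (M := gradSpace)
        (M₂ := gradSpace)) (compression (hA.onTorus p)) := by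
      rw [← he]
      exact contDiffAt_map_inverse (e p)
    have h3 : ContDiffAt ℝ (⊤ : ℕ∞) (fun p => gradSpace.orthogonalProjectionOnto
        (mulOp (hA.onTorus p) K)) p :=
      (gradSpace.orthogonalProjectionOnto.contDiff.comp
        ((contDiff_mulOp_onTorus hA).clm_apply contDiff_const)).contDiffAt
    exact ((h2.comp p h1).clm_apply h3).neg
  · rw [map_add, inner_add_left, ← inner_compression, ← he]
    dsimp only
    rw [← he, ContinuousLinearMap.inverse_equiv, map_neg, inner_neg_left]
    rw [ContinuousLinearEquiv.coe_coe, ContinuousLinearEquiv.coe_coe,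
      ContinuousLinearEquiv.apply_symm_apply,
      Submodule.inner_orthogonalProjectionOnto_eq_of_mem_right]
    ring

theorem equivariant_of_solution
    {A : (Fin 3 → ℝ) → EuclideanSpace ℝ (Fin 2) →L[ℝ] EuclideanSpace ℝ (Fin 2)}
    (hA : SmoothPeriodic A) (hpos : ∀ p v, v ≠ 0 → 0 < (inner ℝ (A p v) v : ℝ))
    (k : EuclideanSpace ℝ (Fin 2)) (v : (Fin 3 → ℝ) → gradSpace)
    (hv : ∀ p (w : gradSpace), inner ℝ
        (mulOp (hA.onTorus p) (ofContinuous (ContinuousMap.const Torus k) + v p))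
          (w : TorusL2) = 0) :
    Equivariant fun p => (v p : TorusL2) := by
  intro p a
  set K := ofContinuous (ContinuousMap.const Torus k) with hK
  have hKt : translate (torusMk a) K = K := by
    rw [hK, translate_ofContinuous]
    rfl
  set u : gradSpace := ⟨translate (torusMk a) (v p), translate_mem_gradSpace a (v p).2⟩
  set q := p + torusShift a
  have hu0 : ∀ w : gradSpace, inner ℝ (mulOp (hA.onTorus q) (K + u)) (w : TorusL2) = 0 := by
    intro w
    have hw : (w : TorusL2) = translate (torusMk a) (translate (torusMk (-a)) w) := by
      rw [translate_translate, ← torusMk_add, add_neg_cancel]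
      exact (translate_zero _).symm
    have h1 := hv p ⟨_, translate_mem_gradSpace (-a) w.2⟩
    rw [← LinearIsometry.inner_map_map (translate (torusMk a)),
      translate_mulOp _ _ _ (hA.onTorus_add p a), map_add, hKt, ← hw] at h1
    exact h1
  obtain ⟨c, hc, h⟩ := exists_coercive_bound (hA.onTorus q) fun x => hpos _
  have h3 := le_inner_mulOp _ c h ((v q - u : gradSpace) : TorusL2)
  have h4 : inner ℝ (mulOp (hA.onTorus q) ((v q - u : gradSpace) : TorusL2))
      ((v q - u : gradSpace) : TorusL2) = 0 := by
    have : ((v q - u : gradSpace) : TorusL2) = (K + v q) - (K + u) := by simp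
    rw [show mulOp (hA.onTorus q) ((v q - u : gradSpace) : TorusL2) =
      mulOp (hA.onTorus q) (K + v q) - mulOp (hA.onTorus q) (K + u) by rw [this, map_sub],
      inner_sub_left, hv, hu0, sub_zero]
  rw [h4] at h3
  have h5 : (inner ℝ ((v q - u : gradSpace) : TorusL2) ((v q - u : gradSpace) : TorusL2) : ℝ) = 0 :=
    le_antisymm (nonpos_of_mul_nonpos_right h3 hc) real_inner_self_nonneg
  have h6 := inner_self_eq_zero.1 h5
  have h7 : v q = u := sub_eq_zero.1 (Subtype.ext h6)
  exact congrArg Subtype.val h7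

end TorusL2

theorem dirDeriv_comp_add_left {X : Type*} [NormedAddCommGroup X] [NormedSpace ℝ X]
    (g : (Fin 3 → ℝ) → X) (e q p : Fin 3 → ℝ) :
    dirDeriv e (fun p => g (q + p)) p = dirDeriv e g (q + p) := by
  simp only [dirDeriv, fderiv_comp_add_left]

theorem dirDeriv_comm {X : Type*} [NormedAddCommGroup X] [NormedSpace ℝ X]
    {g : (Fin 3 → ℝ) → X} (hg : ContDiff ℝ (⊤ : ℕ∞) g) (d e p : Fin 3 → ℝ) :
    dirDeriv d (dirDeriv e g) p = dirDeriv e (dirDeriv d g) p := by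
  have hd : DifferentiableAt ℝ (fderiv ℝ g) p :=
    (hg.fderiv_right (m := (⊤ : ℕ∞)) (by simp)).differentiable (by simp) p
  have h : ∀ c b : Fin 3 → ℝ, dirDeriv c (dirDeriv b g) p = fderiv ℝ (fderiv ℝ g) p c b := by
    intro c b
    have := hd.hasFDerivAt.clm_apply (hasFDerivAt_const b p)
    change fderiv ℝ (fun p => fderiv ℝ g p b) p c = _
    rw [this.fderiv]
    simp
  rw [h, h]
  refine (ContDiffAt.isSymmSndFDerivAt hg.contDiffAt ?_).eq d e
  rw [minSmoothness_of_isRCLikeNormedField]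
  exact WithTop.coe_le_coe.2 (le_top : (2 : ℕ∞) ≤ ⊤)

namespace TorusL2

/-- A periodic field that is a limit of gradients on the torus through `0`
is irrotational at `0`. -/
theorem curl_eq_zero {P : (Fin 3 → ℝ) → EuclideanSpace ℝ (Fin 2)} (hP : SmoothPeriodic P)
    (h : ofContinuous (hP.onTorus 0) ∈ gradSpace) :
    dirDeriv (Pi.single 0 1) (fun p => P p 1) 0 =
      dirDeriv (Pi.single 1 1) (fun p => P p 0) 0 := by
  have hQ : SmoothPeriodic fun p => !₂[P p 1, (-1 : ℝ) * P p 0] :=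
    (hP.proj 1).vec2 ((SmoothPeriodic.const _).mul (hP.proj 0))
  have key := hQ.divergence_eq_zero fun η hη => by
    have hR : SmoothPeriodic fun p => !₂[(-1 : ℝ) * dirDeriv (Pi.single 1 1) η p,
        dirDeriv (Pi.single 0 1) η p] :=
      ((SmoothPeriodic.const _).mul (hη.dirDeriv _)).vec2 (hη.dirDeriv _)
    have h1 := inner_eq_zero_of_mem_gradSpace (v := ofContinuous (hR.onTorus 0)) h fun ζ hζ => by
      rw [inner_ofContinuous]
      have hI : SmoothPeriodic fun p => inner ℝ
          !₂[(-1 : ℝ) * dirDeriv (Pi.single 1 1) η p, dirDeriv (Pi.single 0 1) η p]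
          (torusGrad ζ p) := (hR.prodMk hζ.torusGrad).map contDiff_inner
      have hm : SmoothPeriodic fun p => (-1 : ℝ) * dirDeriv (Pi.single 0 1) η p :=
        (SmoothPeriodic.const _).mul (hη.dirDeriv _)
      have hD0 := hζ.mul ((SmoothPeriodic.const (-1 : ℝ)).mul (hη.dirDeriv (Pi.single 1 1)))
      have hD1 := hζ.mul (hη.dirDeriv (Pi.single 0 1))
      have e := SmoothPeriodic.integral_add_onTorus (hD0.dirDeriv (Pi.single 0 1))
        (hD1.dirDeriv (Pi.single 1 1)) hI (fun p => by
          rw [dirDeriv_mul hζ.contDiff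
            ((SmoothPeriodic.const (-1 : ℝ)).mul (hη.dirDeriv (Pi.single 1 1))).contDiff,
            dirDeriv_mul hζ.contDiff (hη.dirDeriv (Pi.single 0 1)).contDiff,
            dirDeriv_mul contDiff_const (hη.dirDeriv (Pi.single 1 1)).contDiff,
            dirDeriv_comm hη.contDiff (Pi.single 0 1) (Pi.single 1 1)]
          have h0 : dirDeriv (Pi.single 0 1) (fun _ : Fin 3 → ℝ => (-1 : ℝ)) p = 0 := by
            simp [dirDeriv]
          rw [h0]
          simp only [torusGrad, PiLp.inner_apply, Fin.sum_univ_two]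
          simp
          ring) 0
      rw [hD0.integral_dirDeriv_zero, hD1.integral_dirDeriv_one, add_zero] at e
      exact e
    rw [inner_ofContinuous] at h1
    have h2 : (fun x => inner ℝ (hQ.onTorus 0 x) (hη.torusGrad.onTorus 0 x)) =
        fun x => inner ℝ (hR.onTorus 0 x) (hP.onTorus 0 x) := by
      ext x
      change inner ℝ !₂[P _ 1, (-1 : ℝ) * P _ 0] (torusGrad η _) =
        inner ℝ !₂[_, dirDeriv (Pi.single 0 1) η _] (P _)
      simp only [torusGrad, PiLp.inner_apply, Fin.sum_univ_two]
      simp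
      ring
    rw [h2, h1]
  have h0 : dirDeriv (Pi.single 1 1) (fun p => (-1 : ℝ) * P p 0) 0 =
      - dirDeriv (Pi.single 1 1) (fun p => P p 0) 0 := by
    rw [dirDeriv_mul contDiff_const (hP.proj 0).contDiff]
    simp [dirDeriv]
  simp only [Matrix.cons_val_zero, Matrix.cons_val_one] at key
  rw [h0] at key
  linarith

theorem integral_eq_zero_of_mem_gradSpace {P : (Fin 3 → ℝ) → EuclideanSpace ℝ (Fin 2)}
    (hP : SmoothPeriodic P) (h : ofContinuous (hP.onTorus 0) ∈ gradSpace) :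
    ∫ x, hP.onTorus 0 x 0 = 0 := by
  have h1 := inner_eq_zero_of_mem_gradSpace
    (v := ofContinuous (ContinuousMap.const Torus !₂[(1 : ℝ), 0])) h fun η hη => by
      rw [inner_ofContinuous]
      refine Eq.trans ?_ (hη.integral_dirDeriv_zero 0)
      congr 1 with x
      change inner ℝ !₂[(1 : ℝ), 0] (torusGrad η _) = dirDeriv _ η _
      simp [torusGrad, PiLp.inner_apply, Fin.sum_univ_two]
  rw [inner_ofContinuous] at h1
  rw [← h1]
  congr 1 with x
  simp [PiLp.inner_apply, Fin.sum_univ_two]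

end TorusL2

/-- For a smooth family of metrics on the torus there is a smooth family of nontrivial harmonic
one-forms, i.e. of closed forms `α` such that the vector field `A α` is divergence free. -/
theorem exists_harmonic_family
    {A : (Fin 3 → ℝ) → EuclideanSpace ℝ (Fin 2) →L[ℝ] EuclideanSpace ℝ (Fin 2)}
    (hA : SmoothPeriodic A) (hpos : ∀ p v, v ≠ 0 → 0 < (inner ℝ (A p v) v : ℝ)) :
    ∃ α : (Fin 3 → ℝ) → EuclideanSpace ℝ (Fin 2), SmoothPeriodic α ∧
      (∀ p, dirDeriv (Pi.single 0 1) (fun p => α p 1) p =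
        dirDeriv (Pi.single 1 1) (fun p => α p 0) p) ∧
      (∀ p, dirDeriv (Pi.single 0 1) (fun p => A p (α p) 0) p +
        dirDeriv (Pi.single 1 1) (fun p => A p (α p) 1) p = 0) ∧
      ∃ p, α p ≠ 0 := by
  set k : EuclideanSpace ℝ (Fin 2) := !₂[(1 : ℝ), 0] with hk
  obtain ⟨v, hv, hsol⟩ := TorusL2.exists_solution hA hpos k
  have heq := TorusL2.equivariant_of_solution hA hpos k v hsol
  obtain ⟨f, hf, hvf⟩ := heq.exists_smoothPeriodic
    (ContDiff.comp (g := TorusL2.gradSpace.subtypeL) (ContinuousLinearMap.contDiff _) hv)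
  have hα : SmoothPeriodic fun p => k + f p := (SmoothPeriodic.const k).add hf
  have hAα := hA.clm_apply hα
  have hmem : ∀ p, TorusL2.ofContinuous ((hf.comp_add_left p).onTorus 0) ∈ TorusL2.gradSpace := by
    intro p
    rw [hf.onTorus_comp_add_left, add_zero, ← hvf]
    exact (v p).2
  refine ⟨_, hα, fun p => ?_, fun p => ?_, ?_⟩
  · have h1 := TorusL2.curl_eq_zero (hf.comp_add_left p) (hmem p)
    rw [dirDeriv_comp_add_left (fun p => f p 1), dirDeriv_comp_add_left (fun p => f p 0),
      add_zero] at h1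
    have h2 : ∀ (i : Fin 2) e, dirDeriv e (fun p => (k + f p) i) p =
        dirDeriv e (fun p => f p i) p := fun i e => by
      simp [dirDeriv, fderiv_const_add]
    rw [h2, h2, h1]
  · have h1 := (hAα.comp_add_left p).divergence_eq_zero fun η hη => by
      have h2 := hsol p ⟨_, TorusL2.ofContinuous_torusGrad_mem hη⟩
      rw [hvf, ← map_add, TorusL2.mulOp_ofContinuous, TorusL2.inner_ofContinuous] at h2
      rw [hAα.onTorus_comp_add_left, add_zero]
      exact h2
    rw [dirDeriv_comp_add_left (fun p => A p (k + f p) 0),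
      dirDeriv_comp_add_left (fun p => A p (k + f p) 1), add_zero] at h1
    exact h1
  · by_contra! h
    have h1 := TorusL2.integral_eq_zero_of_mem_gradSpace _ (hmem 0)
    have h2 : ∀ x, (hf.comp_add_left 0).onTorus 0 x 0 = -1 := by
      intro x
      have := congrArg (fun v => v 0) (h (0 + (0 + torusShift (torusRep x))))
      simp only [PiLp.add_apply, PiLp.zero_apply, hk] at this
      change f _ 0 = -1
      have h3 : (!₂[(1 : ℝ), 0] : EuclideanSpace ℝ (Fin 2)) 0 = 1 := rfl
      linarith
    simp_rw [h2] at h1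
    rw [integral_const, smul_eq_mul] at h1
    have hW : 0 < (volume : Measure Torus).real Set.univ := by
      rw [measureReal_def, ENNReal.toReal_pos_iff]
      exact ⟨isOpen_univ.measure_pos _ Set.univ_nonempty, measure_lt_top _ _⟩
    linarith

end

theorem pd_apply {w : (Fin 3 → ℝ) → Fin 3 → ℝ} {x : Fin 3 → ℝ} (hw : DifferentiableAt ℝ w x)
    (i j : Fin 3) : pd j (fun y => w y i) x = fderiv ℝ w x (Pi.single j 1) i := by
  have h := (hasFDerivAt_pi'.1 hw.hasFDerivAt i).fderiv
  rw [pd, h]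
  rfl

theorem fderiv_apply_eq_sum {X : Type*} [NormedAddCommGroup X] [NormedSpace ℝ X]
    (L : (Fin 3 → ℝ) →L[ℝ] X) (v : Fin 3 → ℝ) :
    L v = v 0 • L (Pi.single 0 1) + v 1 • L (Pi.single 1 1) + v 2 • L (Pi.single 2 1) := by
  rw [← map_smul, ← map_smul, ← map_smul, ← map_add, ← map_add]
  congr 1
  ext i; fin_cases i <;> simp

theorem dot3_grad (f : (Fin 3 → ℝ) → ℝ) (x v : Fin 3 → ℝ) :
    dot3 (grad f x) v = fderiv ℝ f x v := by
  rw [fderiv_apply_eq_sum]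
  simp [dot3, grad, pd]
  ring

theorem dot3_curl_cross3 {w : (Fin 3 → ℝ) → Fin 3 → ℝ} {x : Fin 3 → ℝ}
    (hw : DifferentiableAt ℝ w x) (u v : Fin 3 → ℝ) :
    dot3 (curl w x) (cross3 u v) = dot3 (fderiv ℝ w x u) v - dot3 (fderiv ℝ w x v) u := by
  rw [fderiv_apply_eq_sum _ u, fderiv_apply_eq_sum _ v]
  simp [dot3, curl, cross3, pd_apply hw]
  ring

/-- The triple product. -/
def det3 (u v w : Fin 3 → ℝ) : ℝ := dot3 (cross3 u v) w

theorem div3_mul_det3 {w : (Fin 3 → ℝ) → Fin 3 → ℝ} {x : Fin 3 → ℝ}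
    (hw : DifferentiableAt ℝ w x) (t u v : Fin 3 → ℝ) :
    div3 w x * det3 t u v = det3 (fderiv ℝ w x t) u v + det3 t (fderiv ℝ w x u) v +
      det3 t u (fderiv ℝ w x v) := by
  rw [fderiv_apply_eq_sum _ t, fderiv_apply_eq_sum _ u, fderiv_apply_eq_sum _ v]
  simp [det3, dot3, div3, cross3, pd_apply hw]
  ring

theorem det3_eq_det (L : (Fin 3 → ℝ) →L[ℝ] Fin 3 → ℝ) :
    det3 (L (Pi.single 0 1)) (L (Pi.single 1 1)) (L (Pi.single 2 1)) =
      LinearMap.det L.toLinearMap := by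
  rw [← LinearMap.det_toMatrix', Matrix.det_fin_three]
  simp [LinearMap.toMatrix'_apply, det3, dot3, cross3]
  ring

theorem cross3_cross3 (u v n : Fin 3 → ℝ) :
    cross3 (cross3 u v) n = dot3 u n • v - dot3 v n • u := by
  ext i; fin_cases i <;> simp [cross3, dot3] <;> ring

theorem det3_mul_dot3 (t u v c n : Fin 3 → ℝ) (ht : dot3 n t = 0) (hu : dot3 n u = 0) :
    det3 t u v * dot3 c n = dot3 n v * dot3 c (cross3 t u) := by
  have : det3 t u v * dot3 c n = dot3 n v * dot3 c (cross3 t u) +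
      dot3 n t * dot3 c (cross3 u v) + dot3 n u * dot3 c (cross3 v t) := by
    simp [det3, dot3, cross3]
    ring
  rw [this, ht, hu]
  ring

theorem dot3_self_pos {v : Fin 3 → ℝ} (hv : v ≠ 0) : 0 < dot3 v v := by
  rw [dot3]
  by_contra! h
  apply hv
  have h0 := mul_self_nonneg (v 0)
  have h1 := mul_self_nonneg (v 1)
  have h2 := mul_self_nonneg (v 2)
  ext i
  fin_cases i <;> exact mul_self_eq_zero.1
    (by simp only [Fin.zero_eta, Fin.mk_one, Fin.reduceFinMk]; linarith)

theorem dot3_self_mul_sub (u v : Fin 3 → ℝ) :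
    dot3 u u * dot3 v v - dot3 u v ^ 2 = dot3 (cross3 u v) (cross3 u v) := by
  simp [dot3, cross3]
  ring

theorem pd_exp_mul {f g : (Fin 3 → ℝ) → ℝ} {x : Fin 3 → ℝ} (hf : DifferentiableAt ℝ f x)
    (hg : DifferentiableAt ℝ g x) (j : Fin 3) :
    pd j (fun y => Real.exp (f y) * g y) x = Real.exp (f x) * (pd j f x * g x + pd j g x) := by
  have := (hf.hasFDerivAt.exp).fun_mul hg.hasFDerivAt
  rw [pd, this.fderiv]
  simp [pd]
  ring

/-- A solenoidal field tangent to the level sets of `Ψ` whose Lorentz force is normal to them can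
be rescaled so that the Lorentz force does not vanish identically. -/
theorem exists_field_of_tangent_field {Ω : Set (Fin 3 → ℝ)} (hΩ : IsOpen Ω)
    {Ψ : (Fin 3 → ℝ) → ℝ} (hΨ : ContDiffOn ℝ (⊤ : ℕ∞) Ψ Ω) (hgrad : ∀ x ∈ Ω, grad Ψ x ≠ 0)
    {w : (Fin 3 → ℝ) → Fin 3 → ℝ} (hw : ContDiffOn ℝ (⊤ : ℕ∞) w Ω)
    (hforce : ∀ x ∈ Ω, cross3 (cross3 (curl w x) (w x)) (grad Ψ x) = 0)
    (hdiv : ∀ x ∈ Ω, div3 w x = 0) (htan : ∀ x ∈ Ω, dot3 (w x) (grad Ψ x) = 0)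
    (hne : ∃ x ∈ Ω, w x ≠ 0) :
    ∃ w : (Fin 3 → ℝ) → (Fin 3 → ℝ),
      ContDiffOn ℝ (⊤ : ℕ∞) w Ω ∧
      (∀ x ∈ Ω, cross3 (cross3 (curl w x) (w x)) (grad Ψ x) = 0) ∧
      (∀ x ∈ Ω, div3 w x = 0) ∧
      (∃ x ∈ Ω, w x ≠ 0) ∧
      (∃ x ∈ Ω, cross3 (curl w x) (w x) ≠ 0) := by
  by_cases hF : ∃ x ∈ Ω, cross3 (curl w x) (w x) ≠ 0
  · exact ⟨w, hw, hforce, hdiv, hne, hF⟩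
  push Not at hF
  have hΨd : ∀ x ∈ Ω, DifferentiableAt ℝ Ψ x := fun x hx =>
    (hΨ.contDiffAt (hΩ.mem_nhds hx)).differentiableAt (by simp)
  have hwd : ∀ x ∈ Ω, DifferentiableAt ℝ w x := fun x hx =>
    (hw.contDiffAt (hΩ.mem_nhds hx)).differentiableAt (by simp)
  have hpd : ∀ x ∈ Ω, ∀ i j, pd j (fun y => Real.exp (Ψ y) * w y i) x =
      Real.exp (Ψ x) * (pd j Ψ x * w x i + pd j (fun y => w y i) x) := fun x hx i j =>
    pd_exp_mul (hΨd x hx) (differentiableAt_pi.1 (hwd x hx) i) j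
  set E : (Fin 3 → ℝ) → Fin 3 → ℝ := fun y i => Real.exp (Ψ y) * w y i with hE
  have hforce' : ∀ x ∈ Ω, cross3 (curl E x) (E x) =
      (-(Real.exp (Ψ x) ^ 2 * dot3 (w x) (w x))) • grad Ψ x := by
    intro x hx
    have hcurl : curl E x = Real.exp (Ψ x) • (curl w x + cross3 (grad Ψ x) (w x)) := by
      ext i; fin_cases i <;> simp [curl, hE, hpd x hx, cross3, grad] <;> ring
    have hE' : E x = Real.exp (Ψ x) • w x := rfl
    have h1 : cross3 (curl E x) (E x) = Real.exp (Ψ x) ^ 2 •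
        (cross3 (curl w x) (w x) + cross3 (cross3 (grad Ψ x) (w x)) (w x)) := by
      rw [hcurl, hE']
      generalize curl w x = c, grad Ψ x = n, w x = v
      ext i; fin_cases i <;> simp [cross3, Matrix.vecHead, Matrix.vecTail] <;> ring
    have h2 : dot3 (grad Ψ x) (w x) = 0 := by
      rw [← htan x hx]; simp only [dot3]; ring
    rw [h1, hF x hx, zero_add, cross3_cross3, h2]
    module
  refine ⟨E, ?_, fun x hx => ?_, fun x hx => ?_, ?_, ?_⟩
  · exact hΨ.exp.smul hw
  · rw [hforce' x hx]
    ext i; fin_cases i <;> simp [cross3] <;> ring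
  · have h1 : div3 E x = Real.exp (Ψ x) * (dot3 (w x) (grad Ψ x) + div3 w x) := by
      simp only [div3, hE, hpd x hx]
      simp [dot3, grad]
      ring
    rw [h1, htan x hx, hdiv x hx]
    simp
  · obtain ⟨x, hx, hwx⟩ := hne
    exact ⟨x, hx, smul_ne_zero (Real.exp_pos (Ψ x)).ne' hwx⟩
  · obtain ⟨x, hx, hwx⟩ := hne
    refine ⟨x, hx, ?_⟩
    rw [hforce' x hx]
    have := dot3_self_pos hwx
    have := Real.exp_pos (Ψ x)
    exact smul_ne_zero (by simp; positivity) (hgrad x hx)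

/-- Injectivity up to the period lattice of the first two coordinates. -/
def InjectiveModPeriods (H : (Fin 3 → ℝ) → Fin 3 → ℝ) : Prop :=
  ∀ p q, H p = H q → ∃ m n : ℤ, q = p + m • Pi.single 0 (2 * π) + n • Pi.single 1 (2 * π)

section

variable {F : Type*} [NormedAddCommGroup F] [NormedSpace ℝ F] {H : (Fin 3 → ℝ) → Fin 3 → ℝ}
  {W : (Fin 3 → ℝ) → F}

theorem apply_invFun (hinj : InjectiveModPeriods H) (hW : SmoothPeriodic W) (p : Fin 3 → ℝ) :
    W (Function.invFun H (H p)) = W p := by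
  obtain ⟨m, n, h⟩ := hinj p _ (Function.invFun_eq (f := H) ⟨p, rfl⟩).symm
  rw [h, hW.add_zsmul]

theorem contDiffAt_comp_invFun (hinj : InjectiveModPeriods H) (hW : SmoothPeriodic W)
    (hH : ContDiff ℝ (⊤ : ℕ∞) H) {p : Fin 3 → ℝ}
    (hdet : LinearMap.det (fderiv ℝ H p).toLinearMap ≠ 0) :
    ContDiffAt ℝ (⊤ : ℕ∞) (fun x => W (Function.invFun H x)) (H p) := by
  have hf' : HasFDerivAt H ((fderiv ℝ H p).toContinuousLinearEquivOfDetNeZero hdet :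
      (Fin 3 → ℝ) →L[ℝ] Fin 3 → ℝ) p := by
    rw [ContinuousLinearMap.coe_toContinuousLinearEquivOfDetNeZero]
    exact (hH.differentiable (by simp) p).hasFDerivAt
  have h1 : ContDiffAt ℝ (⊤ : ℕ∞) (hH.contDiffAt.localInverse hf' (by simp)) (H p) :=
    hH.contDiffAt.to_localInverse hf' (by simp)
  refine (hW.contDiff.contDiffAt.comp (H p) h1).congr_of_eventuallyEq ?_
  filter_upwards [(hH.contDiffAt.hasStrictFDerivAt' hf' (by simp)).eventually_right_inverse]
    with y hy
  have h2 := apply_invFun hinj hW (hH.contDiffAt.localInverse hf' (by simp) y)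
  change H (hH.contDiffAt.localInverse hf' (by simp) y) = y at hy
  rwa [hy] at h2

theorem contDiffOn_comp_invFun (hinj : InjectiveModPeriods H) (hW : SmoothPeriodic W)
    (hH : ContDiff ℝ (⊤ : ℕ∞) H)
    (hdet : ∀ p, LinearMap.det (fderiv ℝ H p).toLinearMap ≠ 0) :
    ContDiffOn ℝ (⊤ : ℕ∞) (fun x => W (Function.invFun H x)) (Set.range H) := by
  rintro _ ⟨p, rfl⟩
  exact (contDiffAt_comp_invFun hinj hW hH (hdet p)).contDiffWithinAt

theorem fderiv_comp_invFun (hinj : InjectiveModPeriods H) (hW : SmoothPeriodic W)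
    (hH : ContDiff ℝ (⊤ : ℕ∞) H) {p : Fin 3 → ℝ}
    (hdet : LinearMap.det (fderiv ℝ H p).toLinearMap ≠ 0) (e : Fin 3 → ℝ) :
    fderiv ℝ (fun x => W (Function.invFun H x)) (H p) (dirDeriv e H p) = dirDeriv e W p := by
  have h1 : HasFDerivAt (fun x => W (Function.invFun H x)) _ (H p) :=
    ((contDiffAt_comp_invFun hinj hW hH hdet).differentiableAt (by simp)).hasFDerivAt
  have h2 := h1.comp p (hH.differentiable (by simp) p).hasFDerivAt
  have h3 : (fun x => W (Function.invFun H x)) ∘ H = W := funext (apply_invFun hinj hW)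
  rw [h3] at h2
  simp only [dirDeriv, h2.fderiv]
  rfl

end

section

variable {X : Type*} [NormedAddCommGroup X] [NormedSpace ℝ X]

theorem hasDerivAt_add_smul (p e : Fin 3 → ℝ) :
    HasDerivAt (fun t : ℝ => p + t • e) e 0 := by
  simpa using ((hasDerivAt_id (0 : ℝ)).smul_const e).const_add p

theorem hasDerivAt_line {g : (Fin 3 → ℝ) → X} (hg : ContDiff ℝ (⊤ : ℕ∞) g) (e p : Fin 3 → ℝ) :
    HasDerivAt (fun t : ℝ => g (p + t • e)) (dirDeriv e g p) 0 := by
  simpa using hasDerivAt_dirDeriv hg (hasDerivAt_add_smul p e)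

theorem dirDeriv_eq_of_hasDerivAt {g : (Fin 3 → ℝ) → X} (hg : ContDiff ℝ (⊤ : ℕ∞) g)
    {e p : Fin 3 → ℝ} {c : X} (h : HasDerivAt (fun t : ℝ => g (p + t • e)) c 0) :
    dirDeriv e g p = c :=
  (hasDerivAt_line hg e p).unique h

end

theorem contDiff_dot3 {f g : (Fin 3 → ℝ) → Fin 3 → ℝ} (hf : ContDiff ℝ (⊤ : ℕ∞) f)
    (hg : ContDiff ℝ (⊤ : ℕ∞) g) : ContDiff ℝ (⊤ : ℕ∞) fun p => dot3 (f p) (g p) := by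
  unfold dot3
  fun_prop

theorem contDiff_det3 {f g h : (Fin 3 → ℝ) → Fin 3 → ℝ} (hf : ContDiff ℝ (⊤ : ℕ∞) f)
    (hg : ContDiff ℝ (⊤ : ℕ∞) g) (hh : ContDiff ℝ (⊤ : ℕ∞) h) :
    ContDiff ℝ (⊤ : ℕ∞) fun p => det3 (f p) (g p) (h p) := by
  simp only [det3, dot3, cross3, Matrix.cons_val]
  fun_prop

theorem dirDeriv_dot3 {f g : (Fin 3 → ℝ) → Fin 3 → ℝ} (hf : ContDiff ℝ (⊤ : ℕ∞) f)
    (hg : ContDiff ℝ (⊤ : ℕ∞) g) (e p : Fin 3 → ℝ) :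
    dirDeriv e (fun p => dot3 (f p) (g p)) p =
      dot3 (dirDeriv e f p) (g p) + dot3 (f p) (dirDeriv e g p) := by
  refine dirDeriv_eq_of_hasDerivAt (contDiff_dot3 hf hg) ?_
  have h1 := hasDerivAt_pi.1 (hasDerivAt_line hf e p)
  have h2 := hasDerivAt_pi.1 (hasDerivAt_line hg e p)
  refine ((((h1 0).mul (h2 0)).add ((h1 1).mul (h2 1))).add ((h1 2).mul (h2 2))).congr_deriv ?_
  simp [dot3]
  ring

theorem dirDeriv_det3 {f g h : (Fin 3 → ℝ) → Fin 3 → ℝ} (hf : ContDiff ℝ (⊤ : ℕ∞) f)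
    (hg : ContDiff ℝ (⊤ : ℕ∞) g) (hh : ContDiff ℝ (⊤ : ℕ∞) h) (e p : Fin 3 → ℝ) :
    dirDeriv e (fun p => det3 (f p) (g p) (h p)) p =
      det3 (dirDeriv e f p) (g p) (h p) + det3 (f p) (dirDeriv e g p) (h p) +
        det3 (f p) (g p) (dirDeriv e h p) := by
  refine dirDeriv_eq_of_hasDerivAt (contDiff_det3 hf hg hh) ?_
  have h1 := hasDerivAt_pi.1 (hasDerivAt_line hf e p)
  have h2 := hasDerivAt_pi.1 (hasDerivAt_line hg e p)
  have h3 := hasDerivAt_pi.1 (hasDerivAt_line hh e p)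
  have key : ∀ i j, HasDerivAt
      (fun t : ℝ => f (p + t • e) i * g (p + t • e) j - f (p + t • e) j * g (p + t • e) i) _ 0 :=
    fun i j => ((h1 i).mul (h2 j)).sub ((h1 j).mul (h2 i))
  refine ((((key 1 2).mul (h3 0)).add ((key 2 0).mul (h3 1))).add
    ((key 0 1).mul (h3 2))).congr_deriv ?_
  simp [det3, dot3, cross3]
  ring

namespace SmoothPeriodic

theorem dot3 {f g : (Fin 3 → ℝ) → Fin 3 → ℝ} (hf : SmoothPeriodic f) (hg : SmoothPeriodic g) :
    SmoothPeriodic fun p => dot3 (f p) (g p) where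
  contDiff := contDiff_dot3 hf.contDiff hg.contDiff
  periodic₀ p := by rw [hf.periodic₀, hg.periodic₀]
  periodic₁ p := by rw [hf.periodic₁, hg.periodic₁]

theorem det3 {f g h : (Fin 3 → ℝ) → Fin 3 → ℝ} (hf : SmoothPeriodic f) (hg : SmoothPeriodic g)
    (hh : SmoothPeriodic h) : SmoothPeriodic fun p => det3 (f p) (g p) (h p) where
  contDiff := contDiff_det3 hf.contDiff hg.contDiff hh.contDiff
  periodic₀ p := by rw [hf.periodic₀, hg.periodic₀, hh.periodic₀]
  periodic₁ p := by rw [hf.periodic₁, hg.periodic₁, hh.periodic₁]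

theorem inv {f : (Fin 3 → ℝ) → ℝ} (hf : SmoothPeriodic f) (h : ∀ p, f p ≠ 0) :
    SmoothPeriodic fun p => (f p)⁻¹ where
  contDiff := hf.contDiff.inv h
  periodic₀ p := by rw [hf.periodic₀]
  periodic₁ p := by rw [hf.periodic₁]

end SmoothPeriodic

section

variable {H W : (Fin 3 → ℝ) → Fin 3 → ℝ}

/-- In curvilinear coordinates `H` the curl is computed from the covariant components. -/
theorem dirDeriv_dot3_sub (hH : ContDiff ℝ (⊤ : ℕ∞) H) (hW : ContDiff ℝ (⊤ : ℕ∞) W)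
    (d e p : Fin 3 → ℝ) :
    dirDeriv d (fun p => dot3 (W p) (dirDeriv e H p)) p -
      dirDeriv e (fun p => dot3 (W p) (dirDeriv d H p)) p =
    dot3 (dirDeriv d W p) (dirDeriv e H p) - dot3 (dirDeriv e W p) (dirDeriv d H p) := by
  rw [dirDeriv_dot3 hW (contDiff_dirDeriv hH e), dirDeriv_dot3 hW (contDiff_dirDeriv hH d),
    dirDeriv_comm hH d e]
  ring

/-- In curvilinear coordinates `H` the divergence is computed from the contravariant components. -/
theorem dirDeriv_det3_add (hH : ContDiff ℝ (⊤ : ℕ∞) H) (hW : ContDiff ℝ (⊤ : ℕ∞) W)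
    (c d e p : Fin 3 → ℝ) :
    dirDeriv c (fun p => det3 (W p) (dirDeriv d H p) (dirDeriv e H p)) p +
      dirDeriv d (fun p => det3 (dirDeriv c H p) (W p) (dirDeriv e H p)) p +
      dirDeriv e (fun p => det3 (dirDeriv c H p) (dirDeriv d H p) (W p)) p =
    det3 (dirDeriv c W p) (dirDeriv d H p) (dirDeriv e H p) +
      det3 (dirDeriv c H p) (dirDeriv d W p) (dirDeriv e H p) +
      det3 (dirDeriv c H p) (dirDeriv d H p) (dirDeriv e W p) := by
  have hc := contDiff_dirDeriv hH c
  have hd := contDiff_dirDeriv hH d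
  have he := contDiff_dirDeriv hH e
  rw [dirDeriv_det3 hW hd he, dirDeriv_det3 hc hW he, dirDeriv_det3 hc hd hW,
    dirDeriv_comm hH c d, dirDeriv_comm hH c e, dirDeriv_comm hH d e]
  simp only [det3, dot3, cross3, Matrix.cons_val]
  ring

end

/-- The symmetric matrix `!![a, b; b, c]` acting on the Euclidean plane. -/
noncomputable def symmMap (a b c : ℝ) :
    EuclideanSpace ℝ (Fin 2) →L[ℝ] EuclideanSpace ℝ (Fin 2) :=
  a • (EuclideanSpace.proj 0 : EuclideanSpace ℝ (Fin 2) →L[ℝ] ℝ).smulRight !₂[(1 : ℝ), 0] +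
  b • ((EuclideanSpace.proj 0 : EuclideanSpace ℝ (Fin 2) →L[ℝ] ℝ).smulRight !₂[(0 : ℝ), 1] +
    (EuclideanSpace.proj 1 : EuclideanSpace ℝ (Fin 2) →L[ℝ] ℝ).smulRight !₂[(1 : ℝ), 0]) +
  c • (EuclideanSpace.proj 1 : EuclideanSpace ℝ (Fin 2) →L[ℝ] ℝ).smulRight !₂[(0 : ℝ), 1]

theorem symmMap_apply_zero (a b c : ℝ) (v : EuclideanSpace ℝ (Fin 2)) :
    symmMap a b c v 0 = a * v 0 + b * v 1 := by
  simp [symmMap]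

theorem symmMap_apply_one (a b c : ℝ) (v : EuclideanSpace ℝ (Fin 2)) :
    symmMap a b c v 1 = b * v 0 + c * v 1 := by
  simp [symmMap]

theorem inner_symmMap (a b c : ℝ) (v : EuclideanSpace ℝ (Fin 2)) :
    inner ℝ (symmMap a b c v) v = a * v 0 ^ 2 + 2 * b * v 0 * v 1 + c * v 1 ^ 2 := by
  simp [PiLp.inner_apply, Fin.sum_univ_two, symmMap_apply_zero, symmMap_apply_one]
  ring

theorem SmoothPeriodic.symmMap {a b c : (Fin 3 → ℝ) → ℝ} (ha : SmoothPeriodic a)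
    (hb : SmoothPeriodic b) (hc : SmoothPeriodic c) :
    SmoothPeriodic fun p => symmMap (a p) (b p) (c p) :=
  ((ha.smul (.const _)).add (hb.smul (.const _))).add (hc.smul (.const _))

theorem exists_sign_mul_pos {J : (Fin 3 → ℝ) → ℝ} (hJ : Continuous J) (hne : ∀ p, J p ≠ 0) :
    ∃ ε : ℝ, ∀ p, 0 < ε * J p := by
  by_cases h : 0 < J 0
  · refine ⟨1, fun p => ?_⟩
    by_contra! hp
    obtain ⟨q, hq⟩ := mem_range_of_exists_le_of_exists_ge hJ (c := 0) ⟨p, by linarith⟩ ⟨0, h.le⟩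
    exact hne q hq
  · refine ⟨-1, fun p => ?_⟩
    by_contra! hp
    obtain ⟨q, hq⟩ := mem_range_of_exists_le_of_exists_ge hJ (c := 0) ⟨0, not_lt.1 h⟩
      ⟨p, by linarith⟩
    exact hne q hq

/-- For a smooth family of immersed tori there is a family of tangent fields which, in the
coordinates of the family, has no normal component of the curl and is solenoidal. -/
theorem exists_tangent_field {H : (Fin 3 → ℝ) → Fin 3 → ℝ} (hH : SmoothPeriodic H)
    (hdet : ∀ p, LinearMap.det (fderiv ℝ H p).toLinearMap ≠ 0) :
    ∃ W : (Fin 3 → ℝ) → Fin 3 → ℝ, SmoothPeriodic W ∧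
      (∀ p, det3 (dirDeriv (Pi.single 0 1) H p) (dirDeriv (Pi.single 1 1) H p) (W p) = 0) ∧
      (∀ p, dirDeriv (Pi.single 0 1) (fun p => dot3 (W p) (dirDeriv (Pi.single 1 1) H p)) p =
        dirDeriv (Pi.single 1 1) (fun p => dot3 (W p) (dirDeriv (Pi.single 0 1) H p)) p) ∧
      (∀ p, dirDeriv (Pi.single 0 1) (fun p => det3 (W p) (dirDeriv (Pi.single 1 1) H p)
          (dirDeriv (Pi.single 2 1) H p)) p +
        dirDeriv (Pi.single 1 1) (fun p => det3 (dirDeriv (Pi.single 0 1) H p) (W p)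
          (dirDeriv (Pi.single 2 1) H p)) p = 0) ∧
      ∃ p, W p ≠ 0 := by
  have hJne : ∀ p, det3 (dirDeriv (Pi.single 0 1) H p) (dirDeriv (Pi.single 1 1) H p)
      (dirDeriv (Pi.single 2 1) H p) ≠ 0 := fun p => by
    simpa only [dirDeriv, det3_eq_det] using hdet p
  have hg0 := hH.dirDeriv (Pi.single 0 1)
  have hg1 := hH.dirDeriv (Pi.single 1 1)
  have hg2 := hH.dirDeriv (Pi.single 2 1)
  generalize dirDeriv (Pi.single 0 1) H = g0 at *
  generalize dirDeriv (Pi.single 1 1) H = g1 at *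
  generalize dirDeriv (Pi.single 2 1) H = g2 at *
  obtain ⟨ε, hε⟩ := exists_sign_mul_pos (hg0.det3 (hg1) hg2).contDiff.continuous hJne
  have hεne : ε ≠ 0 := fun h => by simpa [h] using hε 0
  have hne : ∀ p, ∀ v : EuclideanSpace ℝ (Fin 2), v ≠ 0 → v 0 • g1 p - v 1 • g0 p ≠ 0 := by
    intro p v hv h
    have e0 : v 0 * det3 (g0 p) (g1 p) (g2 p) =
        det3 (g0 p) (v 0 • g1 p - v 1 • g0 p) (g2 p) := by
      simp [det3, dot3, cross3]
      ring
    have e1 : v 1 * det3 (g0 p) (g1 p) (g2 p) =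
        det3 (g1 p) (v 0 • g1 p - v 1 • g0 p) (g2 p) := by
      simp [det3, dot3, cross3]
      ring
    rw [h] at e0 e1
    apply hv
    ext i
    fin_cases i
    · exact (mul_eq_zero.1 (e0.trans (by simp [det3, dot3, cross3]))).resolve_right (hJne p)
    · exact (mul_eq_zero.1 (e1.trans (by simp [det3, dot3, cross3]))).resolve_right (hJne p)
  set D : (Fin 3 → ℝ) → ℝ := fun p =>
    dot3 (g0 p) (g0 p) * dot3 (g1 p) (g1 p) + -1 * (dot3 (g0 p) (g1 p) * dot3 (g0 p) (g1 p))
    with hD_def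
  have hD : SmoothPeriodic D := ((hg0.dot3 hg0).mul (hg1.dot3 hg1)).add
    ((SmoothPeriodic.const _).mul ((hg0.dot3 hg1).mul (hg0.dot3 hg1)))
  have hDpos : ∀ p, 0 < D p := by
    intro p
    have h1 : D p = dot3 (cross3 (g0 p) (g1 p)) (cross3 (g0 p) (g1 p)) := by
      rw [← dot3_self_mul_sub, hD_def]
      ring
    rw [h1]
    refine dot3_self_pos fun h => hJne p ?_
    rw [det3, h]
    simp [dot3]
  have hDne : ∀ p, D p ≠ 0 := fun p => (hDpos p).ne'
  have hDi := hD.inv hDne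
  have hk : SmoothPeriodic fun p => ε * det3 (g0 p) (g1 p) (g2 p) * (D p)⁻¹ :=
    ((SmoothPeriodic.const ε).mul (hg0.det3 hg1 hg2)).mul hDi
  have hkpos : ∀ p, 0 < ε * det3 (g0 p) (g1 p) (g2 p) * (D p)⁻¹ := fun p =>
    mul_pos (hε p) (inv_pos.2 (hDpos p))
  have hA : SmoothPeriodic fun p => symmMap
      (ε * det3 (g0 p) (g1 p) (g2 p) * (D p)⁻¹ * dot3 (g1 p) (g1 p))
      (-1 * (ε * det3 (g0 p) (g1 p) (g2 p) * (D p)⁻¹ * dot3 (g0 p) (g1 p)))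
      (ε * det3 (g0 p) (g1 p) (g2 p) * (D p)⁻¹ * dot3 (g0 p) (g0 p)) :=
    (hk.mul (hg1.dot3 hg1)).symmMap ((SmoothPeriodic.const _).mul (hk.mul (hg0.dot3 hg1)))
      (hk.mul (hg0.dot3 hg0))
  obtain ⟨α, hα, hcurl, hdiv, p₀, hp₀⟩ := exists_harmonic_family hA (fun p v hv => by
    have h1 := mul_pos (hkpos p) (dot3_self_pos (hne p v hv))
    rw [inner_symmMap]
    refine h1.trans_eq ?_
    simp only [dot3, Pi.sub_apply, Pi.smul_apply, smul_eq_mul]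
    ring)
  have hα0 := hα.proj 0
  have hα1 := hα.proj 1
  set W : (Fin 3 → ℝ) → Fin 3 → ℝ := fun p =>
    ((D p)⁻¹ * (dot3 (g1 p) (g1 p) * α p 0 + -1 * (dot3 (g0 p) (g1 p) * α p 1))) • g0 p +
    ((D p)⁻¹ * (dot3 (g0 p) (g0 p) * α p 1 + -1 * (dot3 (g0 p) (g1 p) * α p 0))) • g1 p with hW_def
  have hW : SmoothPeriodic W :=
    ((hDi.mul (((hg1.dot3 hg1).mul hα0).add
      ((SmoothPeriodic.const _).mul ((hg0.dot3 hg1).mul hα1)))).smul hg0).add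
    ((hDi.mul (((hg0.dot3 hg0).mul hα1).add
      ((SmoothPeriodic.const _).mul ((hg0.dot3 hg1).mul hα0)))).smul hg1)
  have hdl : ∀ (a b : ℝ) (u v n : Fin 3 → ℝ),
      dot3 (a • u + b • v) n = a * dot3 u n + b * dot3 v n := fun a b u v n => by
    simp [dot3]
    ring
  have hcomm : ∀ u v, dot3 u v = dot3 v u := fun u v => by simp only [dot3]; ring
  have hW0 : ∀ p, dot3 (W p) (g0 p) = α p 0 := by
    intro p
    have := hDne p
    rw [hW_def, hdl, hcomm (g1 p) (g0 p)]
    field_simp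
    rw [hD_def]
    ring
  have hW1 : ∀ p, dot3 (W p) (g1 p) = α p 1 := by
    intro p
    have := hDne p
    rw [hW_def, hdl]
    field_simp
    rw [hD_def]
    ring
  refine ⟨W, hW, fun p => ?_, fun p => ?_, fun p => ?_, p₀, fun h => hp₀ ?_⟩
  · simp [hW_def, det3, dot3, cross3]
    ring
  · simp only [hW0, hW1]
    exact hcurl p
  · have e0 : ∀ p, det3 (W p) (g1 p) (g2 p) = ε⁻¹ * symmMap
        (ε * det3 (g0 p) (g1 p) (g2 p) * (D p)⁻¹ * dot3 (g1 p) (g1 p))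
        (-1 * (ε * det3 (g0 p) (g1 p) (g2 p) * (D p)⁻¹ * dot3 (g0 p) (g1 p)))
        (ε * det3 (g0 p) (g1 p) (g2 p) * (D p)⁻¹ * dot3 (g0 p) (g0 p)) (α p) 0 := by
      intro p
      simp only [symmMap_apply_zero, hW_def]
      generalize (D p)⁻¹ = d
      field_simp
      simp only [det3, dot3, cross3, Matrix.cons_val, Pi.add_apply, Pi.smul_apply, smul_eq_mul]
      ring
    have e1 : ∀ p, det3 (g0 p) (W p) (g2 p) = ε⁻¹ * symmMap
        (ε * det3 (g0 p) (g1 p) (g2 p) * (D p)⁻¹ * dot3 (g1 p) (g1 p))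
        (-1 * (ε * det3 (g0 p) (g1 p) (g2 p) * (D p)⁻¹ * dot3 (g0 p) (g1 p)))
        (ε * det3 (g0 p) (g1 p) (g2 p) * (D p)⁻¹ * dot3 (g0 p) (g0 p)) (α p) 1 := by
      intro p
      simp only [symmMap_apply_one, hW_def]
      generalize (D p)⁻¹ = d
      field_simp
      simp only [det3, dot3, cross3, Matrix.cons_val, Pi.add_apply, Pi.smul_apply, smul_eq_mul]
      ring
    have hAα := hA.clm_apply hα
    simp only [e0, e1]
    rw [dirDeriv_mul contDiff_const (hAα.proj 0).contDiff,
      dirDeriv_mul contDiff_const (hAα.proj 1).contDiff]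
    have h0 : ∀ e, dirDeriv e (fun _ : Fin 3 → ℝ => ε⁻¹) p = 0 := fun e => by simp [dirDeriv]
    rw [h0, h0, mul_zero, mul_zero, add_zero, add_zero, ← mul_add, hdiv p, mul_zero]
  · ext i
    fin_cases i
    · change α p₀ 0 = 0
      rw [← hW0, h]
      simp [dot3]
    · change α p₀ 1 = 0
      rw [← hW1, h]
      simp [dot3]

/-- A region foliated by the images of tori carries a solenoidal field tangent to the leaves whose
Lorentz force is normal to them and does not vanish identically. -/
theorem exists_field_of_foliation {H : (Fin 3 → ℝ) → Fin 3 → ℝ} (hH : SmoothPeriodic H)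
    (hinj : InjectiveModPeriods H)
    (hdet : ∀ p, LinearMap.det (fderiv ℝ H p).toLinearMap ≠ 0) (hopen : IsOpen (Set.range H))
    {Ψ : (Fin 3 → ℝ) → ℝ} (hΨ : ContDiffOn ℝ (⊤ : ℕ∞) Ψ (Set.range H))
    (hgrad : ∀ x ∈ Set.range H, grad Ψ x ≠ 0)
    (h0 : ∀ p (t : ℝ), Ψ (H (p + t • Pi.single 0 1)) = Ψ (H p))
    (h1 : ∀ p (t : ℝ), Ψ (H (p + t • Pi.single 1 1)) = Ψ (H p)) :
    ∃ w : (Fin 3 → ℝ) → (Fin 3 → ℝ),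
      ContDiffOn ℝ (⊤ : ℕ∞) w (Set.range H) ∧
      (∀ x ∈ Set.range H, cross3 (cross3 (curl w x) (w x)) (grad Ψ x) = 0) ∧
      (∀ x ∈ Set.range H, div3 w x = 0) ∧
      (∃ x ∈ Set.range H, w x ≠ 0) ∧
      (∃ x ∈ Set.range H, cross3 (curl w x) (w x) ≠ 0) := by
  obtain ⟨W, hW, hWtan, hWcurl, hWdiv, p₀, hp₀⟩ := exists_tangent_field hH hdet
  have hnormal : ∀ e : Fin 3 → ℝ, (∀ p (t : ℝ), Ψ (H (p + t • e)) = Ψ (H p)) →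
      ∀ p, dot3 (grad Ψ (H p)) (dirDeriv e H p) = 0 := by
    intro e he p
    rw [dot3_grad]
    have hd : HasFDerivAt Ψ (fderiv ℝ Ψ (H p)) (H (p + (0 : ℝ) • e)) := by
      rw [zero_smul, add_zero]
      exact ((hΨ.contDiffAt (hopen.mem_nhds ⟨p, rfl⟩)).differentiableAt (by simp)).hasFDerivAt
    have hc := hd.comp_hasDerivAt (0 : ℝ) (hasDerivAt_line hH.contDiff e p)
    have hconst : Ψ ∘ (fun t : ℝ => H (p + t • e)) = fun _ => Ψ (H p) := funext (he p)
    rw [hconst] at hc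
    exact hc.unique (hasDerivAt_const 0 _)
  have hn0 := hnormal _ h0
  have hn1 := hnormal _ h1
  have hJne : ∀ p, det3 (dirDeriv (Pi.single 0 1) H p) (dirDeriv (Pi.single 1 1) H p)
      (dirDeriv (Pi.single 2 1) H p) ≠ 0 := fun p => by
    simpa only [dirDeriv, det3_eq_det] using hdet p
  set w : (Fin 3 → ℝ) → Fin 3 → ℝ := fun x => W (Function.invFun H x)
  have hw : ContDiffOn ℝ (⊤ : ℕ∞) w (Set.range H) :=
    contDiffOn_comp_invFun hinj hW hH.contDiff hdet
  have hwH : ∀ p, w (H p) = W p := apply_invFun hinj hW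
  have hwd : ∀ p, DifferentiableAt ℝ w (H p) := fun p =>
    (hw.contDiffAt (hopen.mem_nhds ⟨p, rfl⟩)).differentiableAt (by simp)
  have hDw : ∀ p e, fderiv ℝ w (H p) (dirDeriv e H p) = dirDeriv e W p := fun p e =>
    fderiv_comp_invFun hinj hW hH.contDiff (hdet p) e
  have htan : ∀ p, dot3 (w (H p)) (grad Ψ (H p)) = 0 := by
    intro p
    have := det3_mul_dot3 _ _ (dirDeriv (Pi.single 2 1) H p) (W p) _ (hn0 p) (hn1 p)
    have h2 : dot3 (W p) (cross3 (dirDeriv (Pi.single 0 1) H p) (dirDeriv (Pi.single 1 1) H p)) =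
        0 := by
      rw [← hWtan p]
      simp only [det3, dot3]
      ring
    rw [h2, mul_zero] at this
    rw [hwH]
    exact (mul_eq_zero.1 this).resolve_left (hJne p)
  have hcurl : ∀ p, dot3 (curl w (H p)) (grad Ψ (H p)) = 0 := by
    intro p
    have := det3_mul_dot3 _ _ (dirDeriv (Pi.single 2 1) H p) (curl w (H p)) _ (hn0 p) (hn1 p)
    rw [dot3_curl_cross3 (hwd p), hDw, hDw, ← dirDeriv_dot3_sub hH.contDiff hW.contDiff, hWcurl p,
      sub_self, mul_zero] at this
    exact (mul_eq_zero.1 this).resolve_left (hJne p)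
  refine exists_field_of_tangent_field hopen hΨ hgrad hw ?_ ?_ ?_ ⟨H p₀, ⟨p₀, rfl⟩, by rwa [hwH]⟩
  · rintro _ ⟨p, rfl⟩
    rw [cross3_cross3, hcurl, htan, zero_smul, zero_smul, sub_zero]
  · rintro _ ⟨p, rfl⟩
    have := div3_mul_det3 (hwd p) (dirDeriv (Pi.single 0 1) H p) (dirDeriv (Pi.single 1 1) H p)
      (dirDeriv (Pi.single 2 1) H p)
    have h2 : dirDeriv (Pi.single 2 1) (fun p => det3 (dirDeriv (Pi.single 0 1) H p)
        (dirDeriv (Pi.single 1 1) H p) (W p)) p = 0 := by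
      simp only [hWtan]
      simp [dirDeriv]
    rw [hDw, hDw, hDw, ← dirDeriv_det3_add hH.contDiff hW.contDiff, hWdiv p, h2, add_zero] at this
    exact (mul_eq_zero.1 this).resolve_right (hJne p)
  · rintro _ ⟨p, rfl⟩
    exact htan p

/-- Reparametrization of the third coordinate by an open interval. -/
noncomputable def intervalCoord (a b : ℝ) (p : Fin 3 → ℝ) : Fin 3 → ℝ :=
  Function.update p 2 (a + (b - a) * Real.sigmoid (p 2))

theorem intervalCoord_mem {a b : ℝ} (h : a < b) (p : Fin 3 → ℝ) :
    intervalCoord a b p 2 ∈ Set.Ioo a b := by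
  have h0 := Real.sigmoid_pos (p 2)
  have h1 := Real.sigmoid_lt_one (p 2)
  simp only [intervalCoord, Function.update_self]
  constructor <;> nlinarith

theorem intervalCoord_apply_of_ne {a b : ℝ} {i : Fin 3} (hi : i ≠ 2) (p : Fin 3 → ℝ) :
    intervalCoord a b p i = p i :=
  Function.update_of_ne hi _ _

theorem intervalCoord_add {a b : ℝ} {i : Fin 3} (hi : i ≠ 2) (p : Fin 3 → ℝ) (t : ℝ) :
    intervalCoord a b (p + Pi.single i t) = intervalCoord a b p + Pi.single i t := by
  ext j
  have h : (Pi.single i t : Fin 3 → ℝ) 2 = 0 := Pi.single_eq_of_ne hi.symm _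
  by_cases hj : j = 2
  · subst hj
    simp [intervalCoord, h]
  · simp [intervalCoord, hj]

theorem range_intervalCoord {a b : ℝ} (h : a < b) :
    Set.range (intervalCoord a b) = {p | p 2 ∈ Set.Ioo a b} := by
  refine Set.Subset.antisymm (Set.range_subset_iff.2 (intervalCoord_mem h)) fun p hp => ?_
  obtain ⟨x, hx⟩ : (p 2 - a) / (b - a) ∈ Set.range Real.sigmoid := by
    rw [Real.range_sigmoid]
    exact ⟨div_pos (sub_pos.2 hp.1) (sub_pos.2 h),
      (div_lt_one (sub_pos.2 h)).2 (sub_lt_sub_right hp.2 a)⟩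
  refine ⟨Function.update p 2 x, ?_⟩
  have : b - a ≠ 0 := (sub_pos.2 h).ne'
  simp only [intervalCoord, Function.update_self, Function.update_idem, hx]
  rw [mul_div_cancel₀ _ this, add_sub_cancel, Function.update_eq_self]

theorem contDiff_intervalCoord (a b : ℝ) : ContDiff ℝ (⊤ : ℕ∞) (intervalCoord a b) := by
  refine contDiff_pi.2 fun i => ?_
  by_cases hi : i = 2
  · subst hi
    simp only [intervalCoord, Function.update_self]
    have := contDiff_sigmoid.of_le (m := ((⊤ : ℕ∞) : WithTop ℕ∞)) le_top
    fun_prop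
  · simp only [intervalCoord_apply_of_ne hi]
    fun_prop

theorem dirDeriv_intervalCoord (a b : ℝ) (p : Fin 3 → ℝ) (i : Fin 3) :
    dirDeriv (Pi.single i 1) (intervalCoord a b) p =
      Pi.single i (if i = 2 then (b - a) * (Real.sigmoid (p 2) * (1 - Real.sigmoid (p 2)))
        else 1) := by
  refine dirDeriv_eq_of_hasDerivAt (contDiff_intervalCoord a b) ?_
  refine hasDerivAt_pi.2 fun j => ?_
  have hj := hasDerivAt_pi.1 (hasDerivAt_add_smul p (Pi.single i 1)) j
  by_cases hj2 : j = 2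
  · subst hj2
    simp only [intervalCoord, Function.update_self]
    have hs := Real.hasDerivAt_sigmoid ((p + (0 : ℝ) • (Pi.single i 1 : Fin 3 → ℝ)) 2)
    refine (((hs.comp (0 : ℝ) hj).const_mul (b - a)).const_add a).congr_deriv ?_
    by_cases hi : i = 2
    · subst hi
      simp
    · simp [hi]
  · simp only [intervalCoord_apply_of_ne hj2]
    refine hj.congr_deriv ?_
    by_cases hi : i = 2
    · subst hi
      simp [Pi.single_eq_of_ne hj2]
    · simp [hi]

theorem det_fderiv_comp_intervalCoord_ne_zero {a b : ℝ} (h : a < b) {G : (Fin 3 → ℝ) → Fin 3 → ℝ}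
    (hG : ContDiff ℝ (⊤ : ℕ∞) G) {p : Fin 3 → ℝ}
    (hdet : LinearMap.det (fderiv ℝ G (intervalCoord a b p)).toLinearMap ≠ 0) :
    LinearMap.det (fderiv ℝ (fun p => G (intervalCoord a b p)) p).toLinearMap ≠ 0 := by
  have h1 := (hG.differentiable (by simp) (intervalCoord a b p)).hasFDerivAt.comp p
    ((contDiff_intervalCoord a b).differentiable (by simp) p).hasFDerivAt
  change HasFDerivAt (fun p => G (intervalCoord a b p)) _ p at h1
  rw [h1.fderiv, ContinuousLinearMap.toLinearMap_comp, LinearMap.det_comp]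
  refine mul_ne_zero hdet ?_
  rw [← det3_eq_det]
  have e := dirDeriv_intervalCoord a b p
  simp only [dirDeriv] at e
  simp only [e]
  have h2 := Real.sigmoid_pos (p 2)
  have h3 := Real.sigmoid_lt_one (p 2)
  simp [(sub_pos.2 h).ne', h2.ne', (sub_pos.2 h3).ne', det3, dot3, cross3]

/-- if a bounded domain `Ω ⊂ ℝ³` is foliated by nested toroidal level surfaces of a
smooth function `Ψ` with nonvanishing gradient (precisely: `Ω` is the image of a smooth
diffeomorphism `G` of `(ℝ/2πℤ)² × (s₀,s₁)`, encoded through a smooth doubly `2π`-periodic map with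
nonvanishing Jacobian and injectivity modulo the period lattice, satisfying `Ψ(G(μ,ν,s)) = s`),
then there is a nontrivial smooth solenoidal vector field `w` on `Ω` with
`[(∇×w)×w]×∇Ψ = 0` and `∇·w = 0`, such that `w` and `∇×w` are not everywhere collinear. -/
theorem exists_smooth_foliated_solenoidal_field
    (Ω : Set (Fin 3 → ℝ)) (hΩopen : IsOpen Ω) (hΩconn : IsConnected Ω)
    (hΩbdd : Bornology.IsBounded Ω)
    (Ψ : (Fin 3 → ℝ) → ℝ) (hΨ : ContDiffOn ℝ (⊤ : ℕ∞) Ψ Ω)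
    (hgradΨ : ∀ x ∈ Ω, grad Ψ x ≠ 0)
    (s₀ s₁ : ℝ) (hs : s₀ < s₁)
    (G : (Fin 3 → ℝ) → (Fin 3 → ℝ)) (hG : ContDiff ℝ (⊤ : ℕ∞) G)
    (hGper₁ : ∀ p : Fin 3 → ℝ, G (p + Pi.single 0 (2 * π)) = G p)
    (hGper₂ : ∀ p : Fin 3 → ℝ, G (p + Pi.single 1 (2 * π)) = G p)
    (hGimage : Ω = G '' {p : Fin 3 → ℝ | p 2 ∈ Set.Ioo s₀ s₁})
    (hGinj : ∀ p q : Fin 3 → ℝ, p 2 ∈ Set.Ioo s₀ s₁ → q 2 ∈ Set.Ioo s₀ s₁ → G p = G q →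
      p 2 = q 2 ∧ ∃ m n : ℤ, q 0 = p 0 + 2 * π * m ∧ q 1 = p 1 + 2 * π * n)
    (hGjac : ∀ p : Fin 3 → ℝ, p 2 ∈ Set.Ioo s₀ s₁ →
      LinearMap.det (fderiv ℝ G p).toLinearMap ≠ 0)
    (hΨG : ∀ p : Fin 3 → ℝ, p 2 ∈ Set.Ioo s₀ s₁ → Ψ (G p) = p 2) :
    ∃ w : (Fin 3 → ℝ) → (Fin 3 → ℝ),
      ContDiffOn ℝ (⊤ : ℕ∞) w Ω ∧
      (∀ x ∈ Ω, cross3 (cross3 (curl w x) (w x)) (grad Ψ x) = 0) ∧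
      (∀ x ∈ Ω, div3 w x = 0) ∧
      (∃ x ∈ Ω, w x ≠ 0) ∧
      (∃ x ∈ Ω, cross3 (curl w x) (w x) ≠ 0) := by
  have hmem := intervalCoord_mem hs
  have hrange : Ω = Set.range fun p => G (intervalCoord s₀ s₁ p) := by
    rw [hGimage, ← range_intervalCoord hs, ← Set.range_comp]
    rfl
  have hΨH : ∀ (i : Fin 3), i ≠ 2 → ∀ p (t : ℝ),
      Ψ (G (intervalCoord s₀ s₁ (p + t • Pi.single i 1))) = Ψ (G (intervalCoord s₀ s₁ p)) := by
    intro i hi p t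
    rw [hΨG _ (hmem _), hΨG _ (hmem _), ← Pi.single_smul, intervalCoord_add hi, Pi.add_apply,
      Pi.single_eq_of_ne hi.symm, add_zero]
  subst hrange
  refine exists_field_of_foliation ⟨hG.comp (contDiff_intervalCoord s₀ s₁), fun p => ?_,
    fun p => ?_⟩ (fun p q hpq => ?_)
    (fun p => det_fderiv_comp_intervalCoord_ne_zero hs hG (hGjac _ (hmem p))) hΩopen hΨ hgradΨ
    (hΨH 0 (by decide)) (hΨH 1 (by decide))
  · change G _ = G _
    rw [intervalCoord_add (by decide), hGper₁]
  · change G _ = G _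
    rw [intervalCoord_add (by decide), hGper₂]
  · obtain ⟨h2, m, n, h0, h1⟩ := hGinj _ _ (hmem p) (hmem q) hpq
    rw [intervalCoord_apply_of_ne (by decide), intervalCoord_apply_of_ne (by decide)] at h0 h1
    simp only [intervalCoord, Function.update_self] at h2
    have h3 := Real.sigmoid_injective (mul_left_cancel₀ (sub_pos.2 hs).ne' (add_left_cancel h2))
    refine ⟨m, n, ?_⟩
    ext i
    fin_cases i
    · simp [h0]; ring
    · simp [h1]; ring
    · simp [h3]
end

section
/- Let Ω ⊂ ℝ³ be open, let Ψ : Ω → ℝ be continuously differentiable, and let ξ : Ω → ℝ³ be a continuously differentiable vector field with ∇×ξ = 0, ∇·ξ = 0, and ξ·∇Ψ = 0 on Ω. Let f : ℝ → ℝ be continuously differentiable and set w = f(Ψ) ξ. Then on Ω one has (∇×w)×w = −(1/2) (d(f²)/dΨ)(Ψ) |ξ|² ∇Ψ and ∇·w = 0. In particular [(∇×w)×w]×∇Ψ = 0, so w is a solution of the system [(∇×w)×w]×∇Ψ = 0, ∇·w = 0. -/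
/-- Product and chain rule for the partial derivatives of `f(Ψ) g`. -/
theorem pd_comp_mul (i : Fin 3) {f : ℝ → ℝ} {Ψ g : (Fin 3 → ℝ) → ℝ} {x : Fin 3 → ℝ}
    (hf : DifferentiableAt ℝ f (Ψ x)) (hΨ : DifferentiableAt ℝ Ψ x)
    (hg : DifferentiableAt ℝ g x) :
    pd i (fun y => f (Ψ y) * g y) x =
      f (Ψ x) * pd i g x + deriv f (Ψ x) * pd i Ψ x * g x := by
  have h := (hf.hasDerivAt.comp_hasFDerivAt x hΨ.hasFDerivAt).mul hg.hasFDerivAt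
  unfold pd
  rw [show fderiv ℝ (fun y => f (Ψ y) * g y) x = _ from h.fderiv]
  simp
  ring

/-- if `ξ` is a harmonic (curl-free, divergence-free) vector field tangent to the
level sets of `Ψ`, then `w = f(Ψ) ξ` satisfies
`(∇×w)×w = −(1/2) (f²)'(Ψ) |ξ|² ∇Ψ` and `∇·w = 0`, hence `[(∇×w)×w]×∇Ψ = 0`. -/
theorem harmonic_foliated_field_solves_weak_equilibrium
    (Ω : Set (Fin 3 → ℝ)) (hΩ : IsOpen Ω)
    (Ψ : (Fin 3 → ℝ) → ℝ) (hΨ : ContDiffOn ℝ 1 Ψ Ω)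
    (ξ : (Fin 3 → ℝ) → (Fin 3 → ℝ)) (hξ : ContDiffOn ℝ 1 ξ Ω)
    (hcurl : ∀ x ∈ Ω, curl ξ x = 0)
    (hdiv : ∀ x ∈ Ω, div3 ξ x = 0)
    (htan : ∀ x ∈ Ω, dot3 (ξ x) (grad Ψ x) = 0)
    (f : ℝ → ℝ) (hf : ContDiff ℝ 1 f)
    (w : (Fin 3 → ℝ) → (Fin 3 → ℝ)) (hw : ∀ x, w x = f (Ψ x) • ξ x) :
    (∀ x ∈ Ω, cross3 (curl w x) (w x) =
      (-(1/2) * deriv (fun t => f t ^ 2) (Ψ x) * dot3 (ξ x) (ξ x)) • grad Ψ x) ∧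
    (∀ x ∈ Ω, div3 w x = 0) ∧
    (∀ x ∈ Ω, cross3 (cross3 (curl w x) (w x)) (grad Ψ x) = 0) := by
  obtain rfl : w = fun x => f (Ψ x) • ξ x := funext hw
  have hfd : Differentiable ℝ f := hf.differentiable one_ne_zero
  have hpd : ∀ x ∈ Ω, ∀ i j, pd i (fun y => f (Ψ y) * ξ y j) x =
      f (Ψ x) * pd i (fun y => ξ y j) x + deriv f (Ψ x) * pd i Ψ x * ξ x j := by
    intro x hx i j
    have hn := hΩ.mem_nhds hx
    exact pd_comp_mul i (hfd _) ((hΨ.contDiffAt hn).differentiableAt one_ne_zero)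
      (differentiableAt_pi.1 ((hξ.contDiffAt hn).differentiableAt one_ne_zero) j)
  have hsq : ∀ t, deriv (fun t => f t ^ 2) t = 2 * f t * deriv f t := by
    intro t
    simpa using ((hfd t).hasDerivAt.fun_pow 2).deriv
  have main : ∀ x ∈ Ω, cross3 (curl (fun x => f (Ψ x) • ξ x) x) (f (Ψ x) • ξ x) =
      (-(1/2) * deriv (fun t => f t ^ 2) (Ψ x) * dot3 (ξ x) (ξ x)) • grad Ψ x := by
    intro x hx
    have hc := hcurl x hx
    have ht := htan x hx
    have c0 := congrFun hc 0
    have c1 := congrFun hc 1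
    have c2 := congrFun hc 2
    rw [hsq]
    simp only [curl, dot3, grad, Matrix.cons_val, Pi.zero_apply] at c0 c1 c2 ht
    ext i
    fin_cases i <;>
      simp [cross3, curl, grad, dot3, hpd x hx]
    · linear_combination f (Ψ x) ^ 2 * (c1 * ξ x 2 - c2 * ξ x 1) +
        f (Ψ x) * deriv f (Ψ x) * ξ x 0 * ht
    · linear_combination f (Ψ x) ^ 2 * (c2 * ξ x 0 - c0 * ξ x 2) +
        f (Ψ x) * deriv f (Ψ x) * ξ x 1 * ht
    · linear_combination f (Ψ x) ^ 2 * (c0 * ξ x 1 - c1 * ξ x 0) +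
        f (Ψ x) * deriv f (Ψ x) * ξ x 2 * ht
  refine ⟨main, fun x hx => ?_, fun x hx => ?_⟩
  · have hd := hdiv x hx
    have ht := htan x hx
    simp only [div3, dot3, grad, Matrix.cons_val] at hd ht
    simp only [div3, Pi.smul_apply, smul_eq_mul, hpd x hx]
    linear_combination f (Ψ x) * hd + deriv f (Ψ x) * ht
  · rw [main x hx]
    ext i
    fin_cases i <;> simp [cross3] <;> ring
end

section
/- Fix r₀ > 0, a real ε > 0, and a nonzero integer m. On the open set Ω₀ = {(x,y,z) ∈ ℝ³ : r > 0}, where r = √(x²+y²) and φ is the azimuthal angle, define Ψ_ε = (1/2)[(r−r₀)² + z²] + (1/2) ε sin(mφ). If constant vectors a, b ∈ ℝ³ satisfy (a + b×x)·∇Ψ_ε(x) = 0 for every x ∈ Ω₀, then a = b = 0. Consequently the level sets of Ψ_ε are not invariant under any nontrivial continuous Euclidean isometry. -/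
open scoped Real

/-- The cylindrical radius `r = √(x² + y²)`. -/
noncomputable def cylR (p : Fin 3 → ℝ) : ℝ := Real.sqrt (p 0 ^ 2 + p 1 ^ 2)

/-- The azimuthal angle `φ` of a point of `ℝ³`. -/
noncomputable def cylφ (p : Fin 3 → ℝ) : ℝ := Complex.arg ((p 0 : ℂ) + (p 1 : ℂ) * Complex.I)

theorem hasFDerivAt_cylR {p : Fin 3 → ℝ} (hp : 0 < cylR p) :
    HasFDerivAt cylR ((1 / cylR p) • (p 0 • ContinuousLinearMap.proj (R := ℝ) (φ := fun _ => ℝ) 0 +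
      p 1 • ContinuousLinearMap.proj (R := ℝ) (φ := fun _ => ℝ) 1)) p := by
  have hx (i : Fin 3) : HasFDerivAt (fun q : Fin 3 → ℝ => q i)
      (ContinuousLinearMap.proj (R := ℝ) (φ := fun _ => ℝ) i) p := hasFDerivAt_apply i p
  have hpos : p 0 ^ 2 + p 1 ^ 2 ≠ 0 := (Real.sqrt_pos.mp hp).ne'
  refine ((((hx 0).pow 2).add ((hx 1).pow 2)).sqrt hpos).congr_fderiv ?_
  ext v
  have hp' : √(p 0 ^ 2 + p 1 ^ 2) ≠ 0 := hp.ne'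
  simp [cylR]
  field_simp

theorem hasFDerivAt_cylφ {p : Fin 3 → ℝ} (hp : (p 0 : ℂ) + (p 1 : ℂ) * Complex.I ∈ Complex.slitPlane) :
    HasFDerivAt cylφ
      ((1 / (p 0 ^ 2 + p 1 ^ 2)) • (p 0 • ContinuousLinearMap.proj (R := ℝ) (φ := fun _ => ℝ) 1 -
        p 1 • ContinuousLinearMap.proj (R := ℝ) (φ := fun _ => ℝ) 0)) p := by
  let L : (Fin 3 → ℝ) →L[ℝ] ℂ :=
    Complex.ofRealCLM.comp (ContinuousLinearMap.proj (R := ℝ) (φ := fun _ => ℝ) 0) +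
      (Complex.ofRealCLM.comp (ContinuousLinearMap.proj (R := ℝ) (φ := fun _ => ℝ) 1)).smulRight
        Complex.I
  have hL (q : Fin 3 → ℝ) : L q = (q 0 : ℂ) + (q 1 : ℂ) * Complex.I := by simp [L]
  have hlog := (Complex.hasStrictFDerivAt_log_real hp).hasFDerivAt
  rw [← hL] at hlog
  have key := Complex.imCLM.hasFDerivAt.comp p (hlog.comp p L.hasFDerivAt)
  have hfun : cylφ = Complex.imCLM ∘ Complex.log ∘ L := by
    funext q
    simp [cylφ, hL, Complex.log_im]
  rw [hfun]
  refine key.congr_fderiv ?_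
  ext v
  simp [hL, Complex.inv_re, Complex.inv_im, Complex.normSq_apply]
  ring

theorem grad_perturbed_flux {r₀ ε : ℝ} {m : ℤ} {p : Fin 3 → ℝ} (hr : 0 < cylR p)
    (hp : (p 0 : ℂ) + (p 1 : ℂ) * Complex.I ∈ Complex.slitPlane) :
    grad (fun p => (1/2) * ((cylR p - r₀) ^ 2 + p 2 ^ 2) +
        (1/2) * ε * Real.sin ((m : ℝ) * cylφ p)) p =
      ![(cylR p - r₀) * p 0 / cylR p -
          (1/2) * ε * m * Real.cos (m * cylφ p) * p 1 / (p 0 ^ 2 + p 1 ^ 2),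
        (cylR p - r₀) * p 1 / cylR p +
          (1/2) * ε * m * Real.cos (m * cylφ p) * p 0 / (p 0 ^ 2 + p 1 ^ 2),
        p 2] := by
  have hz : HasFDerivAt (fun q : Fin 3 → ℝ => q 2)
      (ContinuousLinearMap.proj (R := ℝ) (φ := fun _ => ℝ) 2) p := hasFDerivAt_apply 2 p
  have key := (((((hasFDerivAt_cylR hr).sub_const r₀).pow 2).add (hz.pow 2)).const_mul (1/2)).add
    ((((hasFDerivAt_cylφ hp).const_mul (m : ℝ)).sin).const_mul ((1/2) * ε))
  have hd := key.fderiv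
  simp only [Pi.add_def] at hd
  ext i
  fin_cases i <;> simp only [grad, pd, hd] <;> simp <;> ring

/-- the perturbed flux function
`Ψ_ε = (1/2)[(r−r₀)² + z²] + (1/2) ε sin(mφ)` admits no nontrivial continuous Euclidean
isometry: if `(a + b×x)·∇Ψ_ε = 0` on `{r > 0}` then `a = b = 0`. -/
theorem perturbed_torus_no_euclidean_isometry
    (r₀ ε : ℝ) (hr₀ : 0 < r₀) (hε : 0 < ε) (m : ℤ) (hm : m ≠ 0)
    (Ψ : (Fin 3 → ℝ) → ℝ)
    (hΨ : ∀ p : Fin 3 → ℝ, Ψ p =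
      (1/2) * ((cylR p - r₀) ^ 2 + p 2 ^ 2) + (1/2) * ε * Real.sin ((m : ℝ) * cylφ p))
    (a b : Fin 3 → ℝ)
    (h : ∀ p : Fin 3 → ℝ, 0 < cylR p → dot3 (a + cross3 b p) (grad Ψ p) = 0) :
    a = 0 ∧ b = 0 := by
  obtain rfl := funext hΨ
  have hx (x z : ℝ) (hx0 : 0 < x) :
      (a 0 + b 1 * z) * (x - r₀) + (a 1 + b 2 * x - b 0 * z) * ((1/2) * ε * m / x) +
        (a 2 - b 1 * x) * z = 0 := by
    have hr : cylR ![x, 0, z] = x := by simp [cylR, Real.sqrt_sq hx0.le]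
    have hφ : cylφ ![x, 0, z] = 0 := by simp [cylφ, Complex.arg_ofReal_of_nonneg hx0.le]
    have hpos : 0 < cylR ![x, 0, z] := by rwa [hr]
    have := h ![x, 0, z] hpos
    rw [grad_perturbed_flux hpos (by simp [hx0])] at this
    simp [dot3, cross3, hr, hφ] at this
    field_simp at this ⊢
    linear_combination this
  obtain ⟨c, hy⟩ : ∃ c : ℝ, ∀ y z : ℝ, 0 < y →
      -(a 0 + b 1 * z - b 2 * y) * (c / y) + (a 1 - b 0 * z) * (y - r₀) +
        (a 2 + b 0 * y) * z = 0 := by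
    refine ⟨(1/2) * ε * m * Real.cos (m * (π / 2)), fun y z hy0 => ?_⟩
    have hr : cylR ![0, y, z] = y := by simp [cylR, Real.sqrt_sq hy0.le]
    have hφ : cylφ ![0, y, z] = π / 2 := by
      simp [cylφ, Complex.arg_real_mul _ hy0]
    have hpos : 0 < cylR ![0, y, z] := by rwa [hr]
    have := h ![0, y, z] hpos
    rw [grad_perturbed_flux hpos (by simp [Complex.mem_slitPlane_iff, hy0.ne'])] at this
    simp [dot3, cross3, hr, hφ] at this
    field_simp at this ⊢
    linear_combination this
  have he : (1/2) * ε * (m : ℝ) ≠ 0 := by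
    have : (m : ℝ) ≠ 0 := by exact_mod_cast hm
    positivity
  generalize (1/2) * ε * (m : ℝ) = e at hx he
  have h10 := hx 1 0 (by norm_num)
  have h20 := hx 2 0 (by norm_num)
  have h40 := hx 4 0 (by norm_num)
  have h11 := hx 1 1 (by norm_num)
  have h21 := hx 2 1 (by norm_num)
  have k10 := hy 1 0 (by norm_num)
  have k20 := hy 2 0 (by norm_num)
  have k11 := hy 1 1 (by norm_num)
  have k21 := hy 2 1 (by norm_num)
  have ha0 : a 0 = 0 := by linarith
  have ha1 : a 1 = 0 := by
    have : a 1 * e = 0 := by rw [ha0] at h10 h20; linarith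
    simpa [he] using this
  have hb2 : b 2 = 0 := by
    have : b 2 * e = 0 := by rw [ha0, ha1] at h10; linarith
    simpa [he] using this
  have hb0 : b 0 = 0 := by
    have : b 0 * e = 0 := by linarith
    simpa [he] using this
  have ha2 : a 2 = 0 := by
    rw [ha0, ha1, hb0, hb2] at k11 k21
    linarith
  have hb1 : b 1 = 0 := by
    have : b 1 * r₀ = 0 := by
      rw [ha0, ha1, hb0, hb2, ha2] at h11
      linarith
    simpa [hr₀.ne'] using this
  constructor <;> ext i <;> fin_cases i <;> assumption
end
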